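/- arXiv:cs/0606109 — 4 statements merged into one kernel-verified Lean document; each statement's English description precedes it below -/
import Mathlib

section
/- There exists a universal constant C > 0 such that for every finite metric space (X, d_X) with |X| = n ≥ 2 there is a finitely supported probability distribution D over metrics ρ on X such that: every ρ in the support of D is an ultrametric; every ρ dominates d_X (i.e. ρ(x,y) ≥ d_X(x,y) for all x,y ∈ X); and for every x ∈ X, the expectation over D of max_{y ∈ X, y ≠ x} ρ(x,y)/d_X(x,y) is at most C·(log n)². -/
/-- `d` is a metric on `X`. -/
def IsMetric {X : Type*} (d : X → X → ℝ) : Prop :=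
  (∀ x y, 0 ≤ d x y) ∧ (∀ x y, d x y = 0 ↔ x = y) ∧
  (∀ x y, d x y = d y x) ∧ (∀ x y z, d x z ≤ d x y + d y z)

/-- `ρ` is an ultrametric. -/
def IsUltrametric {X : Type*} (ρ : X → X → ℝ) : Prop :=
  ∀ u v w, ρ u v ≤ max (ρ u w) (ρ w v)

open Finset

theorem sum_one_div_abs_sub_le_harmonic (M : ℕ) (k : ℤ) :
    ∑ j ∈ (range M).filter (fun j : ℕ => (j : ℤ) ≠ k), 1 / |(j : ℝ) - k| ≤ 2 * (harmonic M : ℝ) := by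
  have hH : (harmonic M : ℝ) = ∑ i ∈ range M, 1 / ((i : ℝ) + 1) := by
    simp [harmonic]
  have hup : ∑ j ∈ (range M).filter (fun j : ℕ => k < (j : ℤ)), 1 / |(j : ℝ) - k| ≤ harmonic M := by
    rw [hH]
    set c : ℤ := max k (-1) with hc
    refine le_trans (sum_le_sum (g := fun j : ℕ => 1 / ((((j : ℤ) - c - 1).toNat : ℝ) + 1)) ?_) ?_
    · intro j hj
      have hj' := (mem_filter.1 hj).2
      have h1 : (((j : ℤ) - c - 1).toNat : ℤ) = (j : ℤ) - c - 1 := Int.toNat_of_nonneg (by omega)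
      have h2 : (((j : ℤ) - c - 1).toNat : ℝ) = (j : ℝ) - c - 1 := by exact_mod_cast h1
      have h3 : (k : ℝ) ≤ c := by exact_mod_cast le_max_left k (-1)
      have h4 : (c : ℝ) < j := by exact_mod_cast (show c < (j : ℤ) by omega)
      simp only [h2]
      rw [abs_of_nonneg (by linarith)]
      exact one_div_le_one_div_of_le (by linarith) (by linarith)
    · rw [← sum_image (s := (range M).filter (fun j : ℕ => k < (j : ℤ))) (g := fun j : ℕ => ((j : ℤ) - c - 1).toNat)
        (f := fun i : ℕ => 1 / ((i : ℝ) + 1))]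
      · refine sum_le_sum_of_subset_of_nonneg ?_ (fun _ _ _ => by positivity)
        intro i hi
        simp only [mem_image, mem_filter, mem_range] at hi ⊢
        omega
      · intro i hi j hj h
        simp only [coe_filter, mem_range, Set.mem_ofPred_eq] at hi hj h
        omega
  have hdown : ∑ j ∈ (range M).filter (fun j : ℕ => (j : ℤ) < k), 1 / |(j : ℝ) - k| ≤ harmonic M := by
    rw [hH]
    set c : ℤ := min k M with hc
    refine le_trans (sum_le_sum (g := fun j : ℕ => 1 / (((c - (j : ℤ) - 1).toNat : ℝ) + 1)) ?_) ?_
    · intro j hj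
      have hj' := (mem_filter.1 hj).2
      have hj'' := mem_range.1 (mem_filter.1 hj).1
      have h1 : ((c - (j : ℤ) - 1).toNat : ℤ) = c - (j : ℤ) - 1 := Int.toNat_of_nonneg (by omega)
      have h2 : ((c - (j : ℤ) - 1).toNat : ℝ) = c - (j : ℝ) - 1 := by exact_mod_cast h1
      have h3 : (c : ℝ) ≤ k := by exact_mod_cast min_le_left k M
      have h4 : (j : ℝ) < c := by exact_mod_cast (show (j : ℤ) < c by omega)
      simp only [h2]
      rw [abs_of_nonpos (by linarith)]
      exact one_div_le_one_div_of_le (by linarith) (by linarith)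
    · rw [← sum_image (s := (range M).filter (fun j : ℕ => (j : ℤ) < k)) (g := fun j : ℕ => (c - (j : ℤ) - 1).toNat)
        (f := fun i : ℕ => 1 / ((i : ℝ) + 1))]
      · refine sum_le_sum_of_subset_of_nonneg ?_ (fun _ _ _ => by positivity)
        intro i hi
        simp only [mem_image, mem_filter, mem_range] at hi ⊢
        omega
      · intro i hi j hj h
        simp only [coe_filter, mem_range, Set.mem_ofPred_eq] at hi hj h
        omega
  have hsplit : (range M).filter (fun j : ℕ => (j : ℤ) ≠ k) =
      (range M).filter (fun j : ℕ => k < (j : ℤ)) ∪ (range M).filter (fun j : ℕ => (j : ℤ) < k) := by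
    ext j
    simp only [mem_filter, mem_union, mem_range]
    omega
  rw [hsplit, sum_union]
  · linarith
  · rw [disjoint_filter]
    intros
    omega

/-- Among the integers below `2 * n` one is far from `n` weighted reals on average. -/
theorem exists_nat_sum_div_abs_sub_le {X : Type*} (P : Finset X) (ν τ : X → ℝ)
    (hν : ∀ x, 0 ≤ ν x) {n : ℕ} (hn : 0 < n) (hP : P.card ≤ n) :
    ∃ j < 2 * n, (∀ x ∈ P, τ x ≠ j) ∧
      ∑ x ∈ P, ν x / |τ x - j| ≤ 4 * harmonic (2 * n) / n * ∑ x ∈ P, ν x := by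
  classical
  set J : Finset ℕ := {j ∈ range (2 * n) | ∀ x ∈ P, (j : ℤ) ≠ round (τ x)} with hJ
  have hJcard : n ≤ J.card := by
    have h1 : range (2 * n) ⊆ J ∪ P.image (fun x => (round (τ x)).toNat) := by
      intro j hj
      by_cases h : ∀ x ∈ P, (j : ℤ) ≠ round (τ x)
      · exact mem_union_left _ (mem_filter.2 ⟨hj, h⟩)
      · push Not at h
        obtain ⟨x, hx, hxj⟩ := h
        exact mem_union_right _ (mem_image.2 ⟨x, hx, by omega⟩)
    have h2 := (card_le_card h1).trans (card_union_le _ _)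
    have h3 := (card_image_le (s := P) (f := fun x => (round (τ x)).toNat))
    simp only [card_range] at h2
    omega
  have hdist : ∀ (t : ℝ) (j : ℕ), (j : ℤ) ≠ round t → |(j : ℝ) - round t| / 2 ≤ |t - j| := by
    intro t j hj
    have h1 : |t - round t| ≤ 1 / 2 := abs_sub_round t
    have h2 : (1 : ℝ) ≤ |(j : ℝ) - round t| := by
      exact_mod_cast Int.one_le_abs (sub_ne_zero.2 hj)
    have h3 : |(j : ℝ) - round t| ≤ |t - j| + |t - round t| := by
      rw [abs_sub_comm t j]; exact abs_sub_le _ _ _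
    linarith
  have hpos : ∀ (t : ℝ) (j : ℕ), (j : ℤ) ≠ round t → 0 < |(j : ℝ) - round t| := by
    intro t j hj
    rw [abs_pos, sub_ne_zero]
    exact_mod_cast hj
  have hsum : ∑ j ∈ J, ∑ x ∈ P, ν x / |τ x - j| ≤
      ∑ j ∈ J, 4 * harmonic (2 * n) / n * ∑ x ∈ P, ν x := by
    calc ∑ j ∈ J, ∑ x ∈ P, ν x / |τ x - j|
        = ∑ x ∈ P, ∑ j ∈ J, ν x / |τ x - j| := sum_comm
      _ ≤ ∑ x ∈ P, ν x * (4 * harmonic (2 * n)) := by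
          refine sum_le_sum fun x hx => ?_
          calc ∑ j ∈ J, ν x / |τ x - j|
              ≤ ∑ j ∈ J, ν x * (2 * (1 / |(j : ℝ) - round (τ x)|)) := by
                refine sum_le_sum fun j hj => ?_
                have hne := (mem_filter.1 hj).2 x hx
                have h0 := hpos _ _ hne
                rw [div_eq_mul_inv]
                refine mul_le_mul_of_nonneg_left ?_ (hν x)
                have := inv_anti₀ (by positivity) (hdist _ _ hne)
                rwa [inv_div, ← mul_one_div] at this
            _ = ν x * (2 * ∑ j ∈ J, 1 / |(j : ℝ) - round (τ x)|) := by
                rw [mul_sum, mul_sum]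
            _ ≤ ν x * (4 * harmonic (2 * n)) := by
                refine mul_le_mul_of_nonneg_left ?_ (hν x)
                have h1 : ∑ j ∈ J, 1 / |(j : ℝ) - round (τ x)| ≤
                    ∑ j ∈ (range (2 * n)).filter (fun j : ℕ => (j : ℤ) ≠ round (τ x)),
                      1 / |(j : ℝ) - round (τ x)| := by
                  refine sum_le_sum_of_subset_of_nonneg ?_ (fun _ _ _ => by positivity)
                  intro j hj
                  rw [mem_filter] at hj ⊢
                  exact ⟨hj.1, hj.2 x hx⟩
                linarith [sum_one_div_abs_sub_le_harmonic (2 * n) (round (τ x))]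
      _ = 4 * harmonic (2 * n) * ∑ x ∈ P, ν x := by rw [← sum_mul, mul_comm]
      _ ≤ ∑ j ∈ J, 4 * harmonic (2 * n) / n * ∑ x ∈ P, ν x := by
          rw [sum_const, nsmul_eq_mul]
          have hH : (0 : ℝ) ≤ harmonic (2 * n) := by
            exact_mod_cast (harmonic_pos (by omega)).le
          have hS : 0 ≤ ∑ x ∈ P, ν x := sum_nonneg fun x _ => hν x
          have hn' : (0 : ℝ) < n := by exact_mod_cast hn
          have hJ' : (n : ℝ) ≤ J.card := by exact_mod_cast hJcard
          calc 4 * (harmonic (2 * n) : ℝ) * ∑ x ∈ P, ν x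
              = n * (4 * harmonic (2 * n) / n * ∑ x ∈ P, ν x) := by field_simp
            _ ≤ _ := mul_le_mul_of_nonneg_right hJ' (by positivity)
  obtain ⟨j, hj, hle⟩ := exists_le_of_sum_le (card_pos.1 (hn.trans_le hJcard)) hsum
  have hj' := mem_filter.1 hj
  refine ⟨j, mem_range.1 hj'.1, fun x hx h => hj'.2 x hx ?_, hle⟩
  rw [h, round_natCast]

/-- A cut radius in the middle third of `[s, s + w]` whose weighted inverse distance to
finitely many points is logarithmic. -/
theorem exists_mem_Icc_sum_div_abs_sub_le {X : Type*} (P : Finset X) (ν t : X → ℝ)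
    (hν : ∀ x, 0 ≤ ν x) {n : ℕ} (hn : 0 < n) (hP : P.card ≤ n) (s : ℝ) {w : ℝ} (hw : 0 < w) :
    ∃ r ∈ Set.Icc (s + w / 3) (s + 2 * w / 3), (∀ x ∈ P, t x ≠ r) ∧
      ∑ x ∈ P, ν x / |t x - r| ≤ 24 * harmonic (2 * n) / w * ∑ x ∈ P, ν x := by
  have hn' : (0 : ℝ) < n := by exact_mod_cast hn
  set h : ℝ := w / (6 * n) with hh
  have hpos : 0 < h := by positivity
  obtain ⟨j, hj, hne, hle⟩ := exists_nat_sum_div_abs_sub_le P ν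
    (fun x => (t x - (s + w / 3)) / h) hν hn hP
  have hj' : (j : ℝ) ≤ 2 * n := by exact_mod_cast hj.le
  refine ⟨s + w / 3 + j * h, ⟨by nlinarith [mul_nonneg (Nat.cast_nonneg (α := ℝ) j) hpos.le], ?_⟩,
    fun x hx he => hne x hx ?_, ?_⟩
  · have : (j : ℝ) * h ≤ 2 * n * h := mul_le_mul_of_nonneg_right hj' hpos.le
    have h2 : 2 * n * h = w / 3 := by rw [hh]; field_simp; norm_num
    linarith
  · rw [he]; field_simp; ring
  · have key : ∀ x, ν x / |t x - (s + w / 3 + j * h)| =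
        h⁻¹ * (ν x / |(t x - (s + w / 3)) / h - j|) := by
      intro x
      have : t x - (s + w / 3 + j * h) = h * ((t x - (s + w / 3)) / h - j) := by
        field_simp; ring
      rw [this, abs_mul, abs_of_pos hpos]
      rw [div_mul_eq_div_div, div_eq_mul_inv (ν x) h]
      ring
    simp_rw [key]
    rw [← mul_sum]
    calc h⁻¹ * _ ≤ h⁻¹ * (4 * harmonic (2 * n) / n * ∑ x ∈ P, ν x) :=
          mul_le_mul_of_nonneg_left hle (by positivity)
      _ = _ := by rw [hh]; field_simp; ring

/-- If every weighted average of the coordinates is at most `c` at some point of `G`, then some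
finite convex combination of points of `G` has all its coordinates below any `c' > c`. -/
theorem exists_mem_convexHull_lt {X : Type*} [Fintype X] (G : Set (X → ℝ)) {c c' : ℝ}
    (hc : c < c')
    (hG : ∀ μ : X → ℝ, (∀ x, 0 ≤ μ x) → ∑ x, μ x = 1 → ∃ g ∈ G, ∑ x, μ x * g x ≤ c)
    (hne : G.Nonempty) :
    ∃ v ∈ convexHull ℝ G, ∀ x, v x < c' := by
  classical
  by_contra! hcon
  obtain ⟨f, u, hf, hu⟩ := geometric_hahn_banach_open
    (s := Set.univ.pi fun _ : X => Set.Iio c') (t := convexHull ℝ G)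
    (convex_pi fun _ _ => convex_Iio c')
    (isOpen_set_pi Set.finite_univ fun _ _ => isOpen_Iio) (convex_convexHull ℝ G) (by
      rw [Set.disjoint_left]
      intro v hv hv'
      obtain ⟨x, hx⟩ := hcon v hv'
      exact absurd (hv x trivial) (not_lt.2 hx))
  set a : X → ℝ := fun x => f (Pi.single x 1) with ha
  have hfa : ∀ v, f v = ∑ x, v x * a x := by
    intro v
    conv_lhs => rw [pi_eq_sum_univ' v]
    rw [map_sum]
    refine sum_congr rfl fun x _ => ?_
    rw [map_smul, smul_eq_mul, ha]
  have hconst : c * ∑ x, a x < u := by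
    have := hf (fun _ => c) (fun _ _ => hc)
    rwa [hfa, ← mul_sum] at this
  have hnonneg : ∀ x, 0 ≤ a x := by
    intro x
    by_contra! hx
    set K : ℝ := (u - c * ∑ x, a x) / (-a x) with hK
    have hK0 : 0 ≤ K := div_nonneg (by linarith) (by linarith)
    have h1 := hf ((fun _ => c) - K • Pi.single x 1) (fun y _ => by
      have : 0 ≤ (Pi.single x (1 : ℝ) : X → ℝ) y := by
        rw [Pi.single_apply]; split_ifs <;> norm_num
      simp only [Pi.sub_apply, Pi.smul_apply, smul_eq_mul, Set.mem_Iio]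
      nlinarith)
    rw [map_sub, map_smul, hfa, ← mul_sum, smul_eq_mul] at h1
    have h2 : K * (-a x) = u - c * ∑ x, a x := div_mul_cancel₀ _ (by linarith)
    change c * ∑ x, a x - K * a x < u at h1
    linarith
  have hsum : 0 < ∑ x, a x := by
    refine lt_of_le_of_ne (sum_nonneg fun x _ => hnonneg x) fun h0 => ?_
    have hz : ∀ x, a x = 0 := fun x =>
      (sum_eq_zero_iff_of_nonneg fun x _ => hnonneg x).1 h0.symm x (mem_univ x)
    obtain ⟨g, hg⟩ := hne
    have := hu g (subset_convexHull ℝ G hg)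
    rw [hfa] at this
    simp only [hz, mul_zero, sum_const_zero] at this hconst
    linarith
  obtain ⟨g, hg, hle⟩ := hG (fun x => a x / ∑ y, a y) (fun x => div_nonneg (hnonneg x) hsum.le)
    (by rw [← sum_div, div_self hsum.ne'])
  have h1 := hu g (subset_convexHull ℝ G hg)
  rw [hfa] at h1
  have h2 : ∑ x, a x / (∑ y, a y) * g x = (∑ x, g x * a x) / ∑ y, a y := by
    rw [sum_div]; exact sum_congr rfl fun x _ => by ring
  rw [h2, div_le_iff₀ hsum] at hle
  linarith

/-- The `ν`-mass of the points of `S` at which `t` is at most `r`. -/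
noncomputable def massLE {X : Type*} (ν t : X → ℝ) (S : Finset X) (r : ℝ) : ℝ :=
  ∑ y ∈ S with t y ≤ r, ν y

theorem massLE_mono {X : Type*} {ν t : X → ℝ} (hν : ∀ x, 0 ≤ ν x) {S T : Finset X} (hST : S ⊆ T)
    {r r' : ℝ} (hr : r ≤ r') : massLE ν t S r ≤ massLE ν t T r' := by
  refine sum_le_sum_of_subset_of_nonneg (fun x hx => ?_) fun x _ _ => hν x
  rw [mem_filter] at hx ⊢
  exact ⟨hST hx.1, hx.2.trans hr⟩

theorem massLE_le_sum {X : Type*} {ν t : X → ℝ} (hν : ∀ x, 0 ≤ ν x) (S : Finset X) (r : ℝ) :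
    massLE ν t S r ≤ ∑ x ∈ S, ν x :=
  sum_le_sum_of_subset_of_nonneg (filter_subset _ _) fun x _ _ => hν x

theorem le_massLE {X : Type*} {ν t : X → ℝ} (hν : ∀ x, 0 ≤ ν x) {S : Finset X} {r : ℝ} {x : X}
    (hx : x ∈ S) (hr : t x ≤ r) : ν x ≤ massLE ν t S r :=
  single_le_sum (f := ν) (fun y _ => hν y) (mem_filter.2 ⟨hx, hr⟩)

theorem massLE_add_sum {X : Type*} (ν t : X → ℝ) (S : Finset X) {r r' : ℝ} (hr : r ≤ r') :
    massLE ν t S r + ∑ x ∈ S with r < t x ∧ t x ≤ r', ν x = massLE ν t S r' := by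
  classical
  rw [massLE, massLE, ← sum_union]
  · congr 1
    ext x
    simp only [mem_union, mem_filter]
    constructor
    · rintro (h | h)
      · exact ⟨h.1, h.2.trans hr⟩
      · exact ⟨h.1, h.2.2⟩
    · intro h
      rcases le_or_gt (t x) r with h' | h'
      · exact Or.inl ⟨h.1, h'⟩
      · exact Or.inr ⟨h.1, h', h.2⟩
  · rw [disjoint_filter]
    intro x _ h hlt
    exact absurd h (not_le.2 hlt.1)

/-- A cut radius in `[a, a + l]`, kept away from all points outside a short window, such that the
weighted inverse distances of the window points are controlled by the growth of the mass. -/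
theorem exists_cut_radius {X : Type*} (S : Finset X) (ν t : X → ℝ) (hν : ∀ x, 0 ≤ ν x) {n : ℕ}
    (hn : 0 < n) (hS : S.card ≤ n) {N : ℕ} (hN : 0 < N) (a : ℝ) {l : ℝ} (hl : 0 < l)
    (ha : 0 < massLE ν t S a)
    (hgrow : Real.log (massLE ν t S (a + l)) - Real.log (massLE ν t S a) ≤ N) :
    ∃ s r : ℝ, a ≤ s ∧ s + l / N ≤ a + l ∧ s + l / N / 3 ≤ r ∧ r ≤ s + 2 * (l / N) / 3 ∧
      (∀ x ∈ S, s < t x → t x ≤ s + l / N → t x ≠ r) ∧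
      ∑ x ∈ S with s < t x ∧ t x ≤ s + l / N, ν x / |t x - r| ≤
        48 * harmonic (2 * n) / l * (massLE ν t S r *
          (Real.log (massLE ν t S (a + l)) - Real.log (massLE ν t S a))) := by
  have hN' : (0 : ℝ) < N := by exact_mod_cast hN
  set w : ℝ := l / N with hw
  have hw0 : 0 < w := by positivity
  set q : ℝ := Real.log (massLE ν t S (a + l)) - Real.log (massLE ν t S a) with hq
  set V : ℝ → ℝ := massLE ν t S with hV
  have hVmono : ∀ {r r'}, r ≤ r' → V r ≤ V r' := fun h => massLE_mono hν Subset.rfl h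
  have hq0 : 0 ≤ q := sub_nonneg.2 (Real.log_le_log ha (hVmono (by linarith)))
  have hNw : N * w = l := by rw [hw]; field_simp
  obtain ⟨i, hi, hile⟩ := exists_le_of_sum_le (s := range N)
    (f := fun i : ℕ => Real.log (V (a + (i + 1 : ℕ) * w)) - Real.log (V (a + (i : ℕ) * w)))
    (g := fun _ => q / N) (nonempty_range_iff.2 hN.ne') (by
      rw [sum_range_sub (fun i : ℕ => Real.log (V (a + i * w))), sum_const, card_range,
        nsmul_eq_mul, mul_div_cancel₀ _ hN'.ne', Nat.cast_zero, zero_mul, add_zero,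
        mul_div_cancel₀ _ hN'.ne'])
  have hi' : ((i + 1 : ℕ) : ℝ) ≤ N := by exact_mod_cast mem_range.1 hi
  set s : ℝ := a + i * w with hs
  have has : a ≤ s := by rw [hs]; linarith [mul_nonneg (Nat.cast_nonneg (α := ℝ) i) hw0.le]
  have hsw : a + (i + 1 : ℕ) * w = s + w := by rw [hs]; push_cast; ring
  have hswl : s + w ≤ a + l := by
    rw [← hsw, ← hNw]; linarith [mul_le_mul_of_nonneg_right hi' hw0.le]
  rw [hsw] at hile
  have hVs : 0 < V s := ha.trans_le (hVmono has)
  have hVsw : 0 < V (s + w) := hVs.trans_le (hVmono (by linarith))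
  have hmass : ∑ x ∈ S with s < t x ∧ t x ≤ s + w, ν x ≤ V s * (2 * (q / N)) := by
    have h1 := massLE_add_sum ν t S (show s ≤ s + w by linarith)
    have hδ0 : 0 ≤ q / N := by positivity
    have hδ1 : q / N ≤ 1 := (div_le_one hN').2 hgrow
    have h2 : V (s + w) ≤ V s * Real.exp (q / N) := by
      rw [← Real.log_div hVsw.ne' hVs.ne', Real.log_le_iff_le_exp (by positivity),
        div_le_iff₀ hVs] at hile
      linarith
    have h3 := (le_abs_self _).trans
      (Real.abs_exp_sub_one_le (x := q / N) (by rwa [abs_of_nonneg hδ0]))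
    rw [abs_of_nonneg hδ0] at h3
    have h4 : V s * Real.exp (q / N) ≤ V s * (1 + 2 * (q / N)) :=
      mul_le_mul_of_nonneg_left (by linarith) hVs.le
    change V s + _ = V (s + w) at h1
    linarith
  obtain ⟨r, hr, hne, hle⟩ := exists_mem_Icc_sum_div_abs_sub_le
    {x ∈ S | s < t x ∧ t x ≤ s + w} ν t hν hn ((card_filter_le _ _).trans hS) s hw0
  refine ⟨s, r, has, hswl, hr.1, hr.2, fun x hx h1 h2 => hne x (mem_filter.2 ⟨hx, h1, h2⟩), ?_⟩
  have hH : (0 : ℝ) ≤ harmonic (2 * n) := by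
    exact_mod_cast (harmonic_pos (by omega)).le
  calc _ ≤ 24 * harmonic (2 * n) / w * ∑ x ∈ S with s < t x ∧ t x ≤ s + w, ν x := hle
    _ ≤ 24 * harmonic (2 * n) / w * (V s * (2 * (q / N))) :=
        mul_le_mul_of_nonneg_left hmass (by positivity)
    _ = 48 * harmonic (2 * n) / l * (V s * q) := by rw [hw]; field_simp; ring
    _ ≤ 48 * harmonic (2 * n) / l * (V r * q) := by
        refine mul_le_mul_of_nonneg_left (mul_le_mul_of_nonneg_right (hVmono ?_) hq0)
          (by positivity)
        linarith [hr.1]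

/-- The mass-weighted logarithm of the local masses at scale `r`. -/
noncomputable def localEntropy {X : Type*} (d : X → X → ℝ) (ν : X → ℝ) (S : Finset X) (r : ℝ) : ℝ :=
  ∑ x ∈ S, ν x * Real.log (massLE ν (d x) S r)

/-- `ρ` restricts to an ultrametric on `S` of diameter at most `D` dominating `d`. -/
structure IsDominatingUltrametricOn {X : Type*} (d : X → X → ℝ) (S : Finset X) (D : ℝ)
    (ρ : X → X → ℝ) : Prop where
  self : ∀ x ∈ S, ρ x x = 0
  symm : ∀ x ∈ S, ∀ y ∈ S, ρ x y = ρ y x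
  ultra : ∀ x ∈ S, ∀ y ∈ S, ∀ z ∈ S, ρ x y ≤ max (ρ x z) (ρ z y)
  dominates : ∀ x ∈ S, ∀ y ∈ S, d x y ≤ ρ x y
  le_diam : ∀ x ∈ S, ∀ y ∈ S, ρ x y ≤ D

open Classical in
/-- Gluing two functions on the two sides of a cut, using the constant `D` across the cut. -/
noncomputable def glue {X : Type*} (A : Finset X) (D : ℝ) (ρ₁ ρ₂ : X → X → ℝ) (x y : X) : ℝ :=
  if x ∈ A then (if y ∈ A then ρ₁ x y else D) else (if y ∈ A then D else ρ₂ x y)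

theorem IsDominatingUltrametricOn.glue {X : Type*} {d : X → X → ℝ} {S A B : Finset X} {D D₁ : ℝ}
    {ρ₁ ρ₂ : X → X → ℝ} (hS : ∀ x ∈ S, x ∉ A → x ∈ B) (hd : ∀ x ∈ S, ∀ y ∈ S, d x y ≤ D)
    (h₁ : IsDominatingUltrametricOn d A D₁ ρ₁) (hD : D₁ ≤ D)
    (h₂ : IsDominatingUltrametricOn d B D ρ₂) :
    IsDominatingUltrametricOn d S D (glue A D ρ₁ ρ₂) where
  self x hx := by
    by_cases hxA : x ∈ A
    · simp [_root_.glue, hxA, h₁.self x hxA]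
    · simp [_root_.glue, hxA, h₂.self x (hS x hx hxA)]
  symm x hx y hy := by
    by_cases hxA : x ∈ A <;> by_cases hyA : y ∈ A <;> simp [_root_.glue, hxA, hyA]
    · exact h₁.symm x hxA y hyA
    · exact h₂.symm x (hS x hx hxA) y (hS y hy hyA)
  ultra x hx y hy z hz := by
    by_cases hxA : x ∈ A <;> by_cases hyA : y ∈ A <;> by_cases hzA : z ∈ A <;>
      simp only [_root_.glue, hxA, hyA, hzA, if_true, if_false, le_max_iff, le_refl, true_or,
        or_true]
    · exact le_max_iff.1 (h₁.ultra x hxA y hyA z hzA)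
    · exact Or.inl ((h₁.le_diam x hxA y hyA).trans hD)
    · exact Or.inl (h₂.le_diam x (hS x hx hxA) y (hS y hy hyA))
    · exact le_max_iff.1 (h₂.ultra x (hS x hx hxA) y (hS y hy hyA) z (hS z hz hzA))
  dominates x hx y hy := by
    by_cases hxA : x ∈ A <;> by_cases hyA : y ∈ A <;> simp [_root_.glue, hxA, hyA]
    · exact h₁.dominates x hxA y hyA
    · exact hd x hx y hy
    · exact hd x hx y hy
    · exact h₂.dominates x (hS x hx hxA) y (hS y hy hyA)
  le_diam x hx y hy := by
    by_cases hxA : x ∈ A <;> by_cases hyA : y ∈ A <;> simp [_root_.glue, hxA, hyA]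
    · exact (h₁.le_diam x hxA y hyA).trans hD
    · exact h₂.le_diam x (hS x hx hxA) y (hS y hy hyA)

/-- Every subset of a finite metric space carries a dominating ultrametric whose weighted maximum
gradients, above a fixed threshold, are controlled by the local entropy. -/
theorem exists_dominatingUltrametricOn {X : Type*} [Fintype X] (d : X → X → ℝ) (hd : IsMetric d)
    (ν : X → ℝ) (hν : ∀ x, 1 ≤ ν x) {N : ℕ} (hN : 0 < N) (hνN : Real.log (∑ x, ν x) ≤ N)
    (S : Finset X) (D : ℝ) (hD0 : 0 ≤ D) (hD : ∀ x ∈ S, ∀ y ∈ S, d x y ≤ D) :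
    ∃ (ρ : X → X → ℝ) (g : X → ℝ), IsDominatingUltrametricOn d S D ρ ∧ (∀ x, 0 ≤ g x) ∧
      (∀ x ∈ S, ∀ y ∈ S, ρ x y ≤ (24 * N + g x) * d x y) ∧
      ∑ x ∈ S, ν x * g x ≤
        384 * harmonic (2 * Fintype.card X) * localEntropy d ν S (D / 4) := by
  obtain ⟨dnn, deq, dsymm, dtri⟩ := hd
  have dself : ∀ x, d x x = 0 := fun x => (deq x x).2 rfl
  have hν0 : ∀ x, 0 ≤ ν x := fun x => zero_le_one.trans (hν x)
  have hN' : (1 : ℝ) ≤ N := by exact_mod_cast hN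
  have hmass1 : ∀ {T : Finset X} {x : X} {r : ℝ}, x ∈ T → 0 ≤ r → 1 ≤ massLE ν (d x) T r :=
    fun hx hr => (hν _).trans (le_massLE hν0 hx (by rw [dself]; exact hr))
  set K : ℝ := 384 * harmonic (2 * Fintype.card X) with hK
  have hH : (0 : ℝ) ≤ harmonic (2 * Fintype.card X) := by
    rcases Nat.eq_zero_or_pos (Fintype.card X) with h | h
    · simp [h]
    · exact_mod_cast (harmonic_pos (by omega)).le
  have hK0 : 0 ≤ K := by positivity
  induction hc : S.card using Nat.strong_induction_on generalizing S D with
  | _ c ih =>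
  subst hc
  by_cases hsub : ∀ x ∈ S, ∀ y ∈ S, x = y
  · refine ⟨fun _ _ => 0, fun _ => 0, ⟨fun _ _ => rfl, fun _ _ _ _ => rfl, ?_, ?_, ?_⟩,
      fun _ => le_rfl, ?_, ?_⟩
    · intros; simp
    · intro x hx y hy; rw [hsub x hx y hy, dself]
    · intros; exact hD0
    · intro x _ y _
      have := dnn x y
      positivity
    · simp only [mul_zero, sum_const_zero]
      refine mul_nonneg hK0 (sum_nonneg fun x hx => mul_nonneg (hν0 x) (Real.log_nonneg ?_))
      exact hmass1 hx (by positivity)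
  push Not at hsub
  obtain ⟨u₀, hu₀, v₀, hv₀, huv₀⟩ := hsub
  obtain ⟨⟨u, v⟩, huv, hmax⟩ := exists_max_image (S ×ˢ S) (fun p => d p.1 p.2)
    ⟨(u₀, v₀), mem_product.2 ⟨hu₀, hv₀⟩⟩
  obtain ⟨hu, hv⟩ := mem_product.1 huv
  set Δ : ℝ := d u v with hΔ
  have hΔmax : ∀ x ∈ S, ∀ y ∈ S, d x y ≤ Δ := fun x hx y hy =>
    hmax (x, y) (mem_product.2 ⟨hx, hy⟩)
  have hΔ0 : 0 < Δ := by
    refine lt_of_lt_of_le (lt_of_le_of_ne (dnn u₀ v₀) fun h => ?_) (hΔmax u₀ hu₀ v₀ hv₀)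
    exact huv₀ ((deq _ _).1 h.symm)
  have hΔD : Δ ≤ D := hD u hu v hv
  obtain ⟨x₀, hx₀, hmin⟩ := exists_min_image S (fun x =>
    Real.log (massLE ν (d x) S (Δ / 4)) - Real.log (massLE ν (d x) S (Δ / 8))) ⟨u, hu⟩
  have hadd : Δ / 8 + Δ / 8 = Δ / 4 := by ring
  have hcard : 0 < Fintype.card X := Fintype.card_pos_iff.2 ⟨x₀⟩
  obtain ⟨s, r, has, hsl, hr1, hr2, hne, hcost⟩ := exists_cut_radius S ν (d x₀) hν0 hcard
    (card_le_univ S) hN (Δ / 8) (l := Δ / 8) (by positivity)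
    (zero_lt_one.trans_le (hmass1 hx₀ (by positivity))) (by
      rw [hadd]
      have h1 := Real.log_nonneg (hmass1 hx₀ (show 0 ≤ Δ / 8 by positivity))
      have h2 : massLE ν (d x₀) S (Δ / 4) ≤ ∑ x, ν x :=
        (massLE_le_sum hν0 _ _).trans (sum_le_univ_sum_of_nonneg hν0)
      have h3 := Real.log_le_log
        (zero_lt_one.trans_le (hmass1 hx₀ (show 0 ≤ Δ / 4 by positivity))) h2
      linarith)
  rw [hadd] at hcost hsl
  set w : ℝ := Δ / 8 / N with hw
  have hw0 : 0 < w := by positivity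
  have hwN : 24 * N * (w / 3) = Δ := by rw [hw]; field_simp; ring
  have hr0 : 0 ≤ r := by linarith
  have hr4 : r ≤ Δ / 4 := by linarith
  set A : Finset X := {x ∈ S | d x₀ x ≤ r} with hA
  set B : Finset X := {x ∈ S | ¬ d x₀ x ≤ r} with hB
  have hAS : A ⊆ S := filter_subset _ _
  have hBS : B ⊆ S := filter_subset _ _
  have hdA : ∀ x ∈ A, ∀ y ∈ A, d x y ≤ Δ / 2 := by
    intro x hx y hy
    have h1 := (mem_filter.1 hx).2
    have h2 := (mem_filter.1 hy).2
    have h3 := dtri x x₀ y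
    rw [dsymm x x₀] at h3
    linarith
  have hAlt : A.card < S.card := by
    refine card_lt_card ((ssubset_iff_of_subset hAS).2 ?_)
    by_contra! h
    have := hdA u (h u hu) v (h v hv)
    linarith
  have hBlt : B.card < S.card := by
    refine card_lt_card ((ssubset_iff_of_subset hBS).2 ⟨x₀, hx₀, fun h => ?_⟩)
    exact (mem_filter.1 h).2 (by rw [dself]; exact hr0)
  obtain ⟨ρ₁, g₁, hρ₁, hg₁, hgrad₁, hsum₁⟩ := ih _ hAlt A (Δ / 2) (by positivity) hdA rfl
  obtain ⟨ρ₂, g₂, hρ₂, hg₂, hgrad₂, hsum₂⟩ := ih _ hBlt B Δ hΔ0.le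
    (fun x hx y hy => hΔmax x (hBS hx) y (hBS hy)) rfl
  have hSB : ∀ x ∈ S, x ∉ A → x ∈ B := fun x hx hxA =>
    mem_filter.2 ⟨hx, fun h => hxA (mem_filter.2 ⟨hx, h⟩)⟩
  have hglue := IsDominatingUltrametricOn.glue hSB hΔmax hρ₁ (by linarith) hρ₂
  classical
  set e : X → ℝ := fun x => if s < d x₀ x ∧ d x₀ x ≤ s + w then Δ / |d x₀ x - r| else 0 with he
  have he0 : ∀ x, 0 ≤ e x := by
    intro x
    simp only [he]
    split_ifs <;> positivity
  have hcross : ∀ x ∈ S, ∀ D' : ℝ, |d x₀ x - r| ≤ D' → Δ ≤ (24 * N + e x) * D' := by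
    intro x hx D' hD'
    have hD'0 : 0 ≤ D' := (abs_nonneg _).trans hD'
    by_cases h : s < d x₀ x ∧ d x₀ x ≤ s + w
    · have hpos : 0 < |d x₀ x - r| := abs_pos.2 (sub_ne_zero.2 (hne x hx h.1 h.2))
      have h1 : e x = Δ / |d x₀ x - r| := if_pos h
      calc Δ = e x * |d x₀ x - r| := by rw [h1, div_mul_cancel₀ _ hpos.ne']
        _ ≤ e x * D' := mul_le_mul_of_nonneg_left hD' (he0 x)
        _ ≤ _ := mul_le_mul_of_nonneg_right (by linarith) hD'0
    · have h1 : w / 3 ≤ |d x₀ x - r| := by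
        rw [le_abs]
        rw [not_and_or, not_lt, not_le] at h
        rcases h with h | h
        · right; linarith
        · left; linarith
      calc Δ = 24 * N * (w / 3) := hwN.symm
        _ ≤ 24 * N * D' := mul_le_mul_of_nonneg_left (h1.trans hD') (by positivity)
        _ ≤ _ := mul_le_mul_of_nonneg_right (by linarith [he0 x]) hD'0
  refine ⟨glue A Δ ρ₁ ρ₂, fun x => (if x ∈ A then g₁ x else g₂ x) + e x,
    ⟨hglue.self, hglue.symm, hglue.ultra, hglue.dominates,
      fun x hx y hy => (hglue.le_diam x hx y hy).trans hΔD⟩, ?_, ?_, ?_⟩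
  · intro x
    have := he0 x
    have := hg₁ x
    have := hg₂ x
    dsimp only
    split_ifs <;> positivity
  · intro x hx y hy
    have hdxy := dnn x y
    have hex := mul_nonneg (he0 x) hdxy
    have hlip1 : d x₀ y ≤ d x₀ x + d x y := dtri _ _ _
    have hlip2 : d x₀ x ≤ d x₀ y + d x y := by rw [dsymm x y]; exact dtri _ _ _
    by_cases hxA : x ∈ A <;> by_cases hyA : y ∈ A <;>
      simp only [_root_.glue, hxA, hyA, if_true, if_false]
    · linarith [hgrad₁ x hxA y hyA]
    · have h1 := (mem_filter.1 hxA).2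
      have h2 := not_le.1 (mem_filter.1 (hSB y hy hyA)).2
      have := hcross x hx (d x y) (abs_le.2 ⟨by linarith, by linarith⟩)
      linarith [mul_nonneg (hg₁ x) hdxy]
    · have h1 := not_le.1 (mem_filter.1 (hSB x hx hxA)).2
      have h2 := (mem_filter.1 hyA).2
      have := hcross x hx (d x y) (abs_le.2 ⟨by linarith, by linarith⟩)
      linarith [mul_nonneg (hg₂ x) hdxy]
    · linarith [hgrad₂ x (hSB x hx hxA) y (hSB y hy hyA)]
  · have hsplit : ∀ f : X → ℝ, ∑ x ∈ S, f x = ∑ x ∈ A, f x + ∑ x ∈ B, f x := fun f =>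
      (sum_filter_add_sum_filter_not S _ f).symm
    have hBA : ∀ x ∈ B, x ∉ A := fun x hx h => (mem_filter.1 hx).2 (mem_filter.1 h).2
    have hlhs : ∑ x ∈ S, ν x * ((if x ∈ A then g₁ x else g₂ x) + e x) =
        ∑ x ∈ A, ν x * g₁ x + ∑ x ∈ B, ν x * g₂ x + ∑ x ∈ S, ν x * e x := by
      simp_rw [mul_add]
      rw [sum_add_distrib, hsplit (fun x => ν x * (if x ∈ A then g₁ x else g₂ x))]
      congr 2
      · exact sum_congr rfl fun x hx => by rw [if_pos hx]
      · exact sum_congr rfl fun x hx => by rw [if_neg (hBA x hx)]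
    set q : ℝ := Real.log (massLE ν (d x₀) S (Δ / 4)) - Real.log (massLE ν (d x₀) S (Δ / 8)) with hq
    have hesum : ∑ x ∈ S, ν x * e x ≤ K * (massLE ν (d x₀) S r * q) := by
      have h1 : ∑ x ∈ S, ν x * e x =
          Δ * ∑ x ∈ S with s < d x₀ x ∧ d x₀ x ≤ s + w, ν x / |d x₀ x - r| := by
        rw [mul_sum, sum_filter]
        refine sum_congr rfl fun x _ => ?_
        simp only [he]
        split_ifs
        · ring
        · ring
      rw [h1]
      refine (mul_le_mul_of_nonneg_left hcost hΔ0.le).trans_eq ?_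
      rw [hK]
      field_simp
      ring
    have hqA : massLE ν (d x₀) S r * q ≤ ∑ x ∈ A, ν x *
        (Real.log (massLE ν (d x) S (Δ / 4)) - Real.log (massLE ν (d x) S (Δ / 8))) := by
      rw [massLE, sum_mul]
      exact sum_le_sum fun x hx => mul_le_mul_of_nonneg_left (hmin x (hAS hx)) (hν0 x)
    have hΦA : localEntropy d ν A (Δ / 2 / 4) ≤
        ∑ x ∈ A, ν x * Real.log (massLE ν (d x) S (Δ / 8)) := by
      refine sum_le_sum fun x hx => mul_le_mul_of_nonneg_left (Real.log_le_log ?_ ?_) (hν0 x)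
      · exact zero_lt_one.trans_le (hmass1 hx (by positivity))
      · exact massLE_mono hν0 hAS (by linarith)
    have hΦB : localEntropy d ν B (Δ / 4) ≤
        ∑ x ∈ B, ν x * Real.log (massLE ν (d x) S (Δ / 4)) := by
      refine sum_le_sum fun x hx => mul_le_mul_of_nonneg_left (Real.log_le_log ?_ ?_) (hν0 x)
      · exact zero_lt_one.trans_le (hmass1 hx (by positivity))
      · exact massLE_mono hν0 hBS le_rfl
    have hΦS : ∑ x ∈ S, ν x * Real.log (massLE ν (d x) S (Δ / 4)) ≤
        localEntropy d ν S (D / 4) := by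
      refine sum_le_sum fun x hx => mul_le_mul_of_nonneg_left (Real.log_le_log ?_ ?_) (hν0 x)
      · exact zero_lt_one.trans_le (hmass1 hx (by positivity))
      · exact massLE_mono hν0 Subset.rfl (by linarith)
    simp_rw [mul_sub, sum_sub_distrib] at hqA
    rw [hsplit] at hΦS
    rw [hlhs]
    have htotal : localEntropy d ν A (Δ / 2 / 4) + localEntropy d ν B (Δ / 4) +
        massLE ν (d x₀) S r * q ≤ localEntropy d ν S (D / 4) := by linarith
    have := mul_le_mul_of_nonneg_left htotal hK0
    linarith

/-- For every probability weight there is a dominating ultrametric whose weighted average maximum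
gradient is at most a constant times `(log n)²`. -/
theorem exists_ultrametric_sum_iSup_le {X : Type*} [Fintype X] (d : X → X → ℝ) (hd : IsMetric d)
    (hX : 2 ≤ Fintype.card X) (μ : X → ℝ) (hμ : ∀ x, 0 ≤ μ x) (hμ1 : ∑ x, μ x = 1) :
    ∃ ρ : X → X → ℝ, (IsMetric ρ ∧ IsUltrametric ρ ∧ ∀ x y, d x y ≤ ρ x y) ∧
      ∑ x, μ x * (⨆ y : {y : X // y ≠ x}, ρ x y.1 / d x y.1) ≤
        13000 * Real.log (Fintype.card X) ^ 2 := by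
  set n : ℕ := Fintype.card X with hn
  have hn2 : (2 : ℝ) ≤ n := by exact_mod_cast hX
  have hn0 : (0 : ℝ) < n := by linarith
  set ν : X → ℝ := fun x => n * μ x + 1 with hνdef
  have hν : ∀ x, 1 ≤ ν x := fun x => by
    have := mul_nonneg hn0.le (hμ x)
    simp only [hνdef]; linarith
  have hνsum : ∑ x, ν x = 2 * n := by
    simp only [hνdef]
    rw [sum_add_distrib, ← mul_sum, hμ1, sum_const, card_univ, nsmul_eq_mul]
    ring
  set L : ℝ := Real.log n with hL
  have hlog2 : Real.log 2 ≤ L := Real.log_le_log (by norm_num) hn2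
  have hL2 : 1 ≤ 2 * L := by linarith [Real.log_two_gt_d9]
  have hlog2n : Real.log (2 * n) ≤ 2 * L := by
    rw [Real.log_mul (by norm_num) hn0.ne']; linarith
  have hlog2n0 : 0 < Real.log (2 * n) := Real.log_pos (by linarith)
  set N : ℕ := ⌈Real.log (2 * n)⌉₊ with hNdef
  have hN : 0 < N := Nat.ceil_pos.2 hlog2n0
  have hNL : (N : ℝ) ≤ 4 * L := by
    have := Nat.ceil_lt_add_one hlog2n0.le
    linarith
  have hH : (harmonic (2 * n) : ℝ) ≤ 4 * L := by
    have := harmonic_le_one_add_log (2 * n)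
    push_cast at this
    linarith
  have hH0 : (0 : ℝ) ≤ harmonic (2 * n) := by
    exact_mod_cast (harmonic_pos (by omega)).le
  have hd' := hd
  obtain ⟨dnn, deq, dsymm, dtri⟩ := hd'
  set D : ℝ := ∑ x, ∑ y, d x y with hD
  have hDle : ∀ x y, d x y ≤ D := fun x y =>
    (single_le_sum (f := fun y => d x y) (fun y _ => dnn x y) (mem_univ y)).trans
      (single_le_sum (f := fun x => ∑ y, d x y) (fun x _ => sum_nonneg fun y _ => dnn x y)
        (mem_univ x))
  have hD0 : 0 ≤ D := sum_nonneg fun x _ => sum_nonneg fun y _ => dnn x y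
  obtain ⟨ρ, g, hρ, hg, hgrad, hsum⟩ := exists_dominatingUltrametricOn d hd ν hν hN
    (by rw [hνsum]; exact Nat.le_ceil _) univ D hD0 fun x _ y _ => hDle x y
  have hself : ∀ x, ρ x x = 0 := fun x => hρ.self x (mem_univ x)
  have hult : IsUltrametric ρ := fun x y z => hρ.ultra x (mem_univ _) y (mem_univ _) z (mem_univ _)
  have hdom : ∀ x y, d x y ≤ ρ x y := fun x y => hρ.dominates x (mem_univ _) y (mem_univ _)
  have hnn : ∀ x y, 0 ≤ ρ x y := fun x y => (dnn x y).trans (hdom x y)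
  refine ⟨ρ, ⟨⟨hnn, fun x y => ⟨fun h => ?_, fun h => h ▸ hself x⟩,
    fun x y => hρ.symm x (mem_univ _) y (mem_univ _), fun x y z => ?_⟩, hult, hdom⟩, ?_⟩
  · exact (deq x y).1 (le_antisymm (h ▸ hdom x y) (dnn x y))
  · exact (hult x z y).trans (max_le_add_of_nonneg (hnn _ _) (hnn _ _))
  have hN0 : (0 : ℝ) ≤ N := Nat.cast_nonneg N
  have hsup : ∀ x, (⨆ y : {y : X // y ≠ x}, ρ x y.1 / d x y.1) ≤ 24 * N + g x := by
    intro x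
    refine Real.iSup_le (fun y => ?_) (by linarith [hg x])
    have hpos : 0 < d x y.1 := lt_of_le_of_ne (dnn _ _) fun h => y.2 ((deq _ _).1 h.symm).symm
    exact (div_le_iff₀ hpos).2 (hgrad x (mem_univ _) y.1 (mem_univ _))
  have hμν : ∀ x, μ x ≤ ν x / n := fun x => by
    rw [le_div_iff₀ hn0]; simp only [hνdef]; linarith
  have hent : localEntropy d ν univ (D / 4) ≤ 2 * n * N := by
    rw [← hνsum, sum_mul]
    refine sum_le_sum fun x _ => mul_le_mul_of_nonneg_left ?_ (zero_le_one.trans (hν x))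
    have hν0 : ∀ x, 0 ≤ ν x := fun x => zero_le_one.trans (hν x)
    refine (Real.log_le_log (zero_lt_one.trans_le ((hν x).trans
      (le_massLE hν0 (mem_univ x) ?_))) (massLE_le_sum hν0 _ _)).trans ?_
    · rw [(deq x x).2 rfl]; positivity
    · rw [hνsum]; exact Nat.le_ceil _
  have hLsq : 0 ≤ L ^ 2 := sq_nonneg L
  calc ∑ x, μ x * (⨆ y : {y : X // y ≠ x}, ρ x y.1 / d x y.1)
      ≤ ∑ x, ν x / n * (24 * N + g x) := by
        refine sum_le_sum fun x _ => ?_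
        have h0 : 0 ≤ 24 * N + g x := by linarith [hg x]
        exact (mul_le_mul_of_nonneg_left (hsup x) (hμ x)).trans
          (mul_le_mul_of_nonneg_right (hμν x) h0)
    _ = (24 * N * ∑ x, ν x + ∑ x, ν x * g x) / n := by
        rw [mul_sum, ← sum_add_distrib, sum_div]
        exact sum_congr rfl fun x _ => by ring
    _ ≤ (24 * N * (2 * n) + 384 * harmonic (2 * n) * (2 * n * N)) / n := by
        rw [hνsum]
        have := mul_le_mul_of_nonneg_left hent
          (show 0 ≤ 384 * (harmonic (2 * n) : ℝ) by positivity)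
        gcongr
        exact hsum.trans this
    _ = 48 * N + 768 * (harmonic (2 * n) * N) := by field_simp; ring
    _ ≤ 13000 * L ^ 2 := by
        have h1 : (harmonic (2 * n) : ℝ) * N ≤ 4 * L * (4 * L) :=
          mul_le_mul hH hNL hN0 (by linarith)
        nlinarith

/-- There exists a universal constant `C > 0` such that every `n`-point metric space
(`n ≥ 2`) admits a finitely supported distribution over ultrametrics dominating the
metric, with expected maximum gradient at every point at most `C (log n)²`. -/
theorem maximum_gradient_embedding_into_ultrametrics :
    ∃ C : ℝ, 0 < C ∧
      ∀ (X : Type) [Fintype X] (d : X → X → ℝ) (n : ℕ),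
        Fintype.card X = n → 2 ≤ n → IsMetric d →
        ∃ (m : ℕ) (w : Fin m → ℝ) (ρ : Fin m → X → X → ℝ),
          (∀ i, 0 ≤ w i) ∧ (∑ i, w i = 1) ∧
          (∀ i, w i ≠ 0 →
            IsMetric (ρ i) ∧ IsUltrametric (ρ i) ∧ ∀ x y, d x y ≤ ρ i x y) ∧
          (∀ x : X,
            ∑ i, w i * (⨆ y : {y : X // y ≠ x}, ρ i x y.1 / d x y.1) ≤
              C * (Real.log n) ^ 2) := by
  refine ⟨13001, by norm_num, ?_⟩
  intro X _ d n hcard hn hd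
  subst hcard
  have hlog : 0 < Real.log (Fintype.card X) := Real.log_pos (by exact_mod_cast hn)
  set G : Set (X → ℝ) := {v | ∃ ρ : X → X → ℝ,
    (IsMetric ρ ∧ IsUltrametric ρ ∧ ∀ x y, d x y ≤ ρ x y) ∧
      v = fun x => ⨆ y : {y : X // y ≠ x}, ρ x y.1 / d x y.1} with hG
  have hweight : ∀ μ : X → ℝ, (∀ x, 0 ≤ μ x) → ∑ x, μ x = 1 → ∃ v ∈ G,
      ∑ x, μ x * v x ≤ 13000 * Real.log (Fintype.card X) ^ 2 := by
    intro μ hμ hμ1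
    obtain ⟨ρ, hρ, hle⟩ := exists_ultrametric_sum_iSup_le d hd hn μ hμ hμ1
    exact ⟨_, ⟨ρ, hρ, rfl⟩, hle⟩
  have hne : G.Nonempty := by
    have hcard0 : (Fintype.card X : ℝ) ≠ 0 := by positivity
    obtain ⟨v, hv, -⟩ := hweight (fun _ => 1 / Fintype.card X) (fun _ => by positivity)
      (by rw [sum_const, card_univ, nsmul_eq_mul, mul_one_div_cancel hcard0])
    exact ⟨v, hv⟩
  obtain ⟨v, hv, hlt⟩ := exists_mem_convexHull_lt G
    (show 13000 * Real.log (Fintype.card X) ^ 2 < 13001 * Real.log (Fintype.card X) ^ 2 by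
      nlinarith [pow_pos hlog 2]) hweight hne
  obtain ⟨ι, _, w, z, hw0, hw1, hz, rfl⟩ := mem_convexHull_iff_exists_fintype.1 hv
  choose ρ hρ hzρ using hz
  set e := Fintype.equivFin ι
  refine ⟨Fintype.card ι, fun i => w (e.symm i), fun i => ρ (e.symm i), fun i => hw0 _, ?_,
    fun i _ => hρ _, fun x => ?_⟩
  · rw [← hw1]; exact e.symm.sum_comp w
  · rw [e.symm.sum_comp (fun i => w i * (⨆ y : {y : X // y ≠ x}, ρ i x y.1 / d x y.1))]
    refine le_trans (le_of_eq ?_) (hlt x).le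
    rw [Finset.sum_apply]
    refine sum_congr rfl fun i _ => ?_
    rw [Pi.smul_apply, smul_eq_mul, hzρ]
end

section
/- There exists a universal constant C > 0 such that for every finite metric space (X, d_X) with |X| = n ≥ 2 there is a finitely supported probability distribution D over ultrametrics ρ on X dominating d_X such that for every x ∈ X, the expectation over D of max_{y ≠ x} ρ(x,y)/d_X(x,y) is at most C·(1 + (log n)·log Φ(X)), where Φ(X) = (max_{x,y∈X} d_X(x,y)) / (min_{x≠y} d_X(x,y)) is the aspect ratio of X. -/
/-- The smallest label `σ w` of a point `w` in the closed `d`-ball of radius `r` around `x`. -/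
noncomputable def ballLabel {X : Type*} (d : X → X → ℝ) (σ : X → ℕ) (r : ℝ) (x : X) : ℕ :=
  sInf (Set.image σ {w | d x w ≤ r})

/-- The ultrametric obtained by clustering points according to their ball labels at the
radii `b * 2 ^ k`. -/
noncomputable def labelUltrametric {X : Type*} (d : X → X → ℝ) (σ : X → ℕ) (b : ℝ)
    (x y : X) : ℝ :=
  ⨆ k : ℤ, if ballLabel d σ (b * 2 ^ k) x = ballLabel d σ (b * 2 ^ k) y then 0
    else 4 * (b * 2 ^ k)

theorem exists_ballLabel_eq {X : Type*} {d : X → X → ℝ} (hd : IsMetric d) (σ : X → ℕ) {r : ℝ}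
    (hr : 0 ≤ r) (x : X) : ∃ w, d x w ≤ r ∧ σ w = ballLabel d σ r x :=
  Nat.sInf_mem (s := Set.image σ {w | d x w ≤ r})
    ⟨σ x, x, by simpa [(hd.2.1 x x).2 rfl] using hr, rfl⟩

theorem ballLabel_le {X : Type*} (d : X → X → ℝ) (σ : X → ℕ) {r : ℝ} {x w : X}
    (hw : d x w ≤ r) : ballLabel d σ r x ≤ σ w :=
  Nat.sInf_le ⟨w, hw, rfl⟩

theorem lt_of_ballLabel_ne {X : Type*} {d : X → X → ℝ} {σ : X → ℕ} {r D : ℝ}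
    (hD : ∀ x y, d x y ≤ D) {x y : X} (h : ballLabel d σ r x ≠ ballLabel d σ r y) : r < D := by
  by_contra! hr
  have hball : ∀ z, {w | d z w ≤ r} = Set.univ :=
    fun z => Set.eq_univ_of_forall fun w => (hD z w).trans hr
  exact h (by simp [ballLabel, hball])

section LabelUltrametric

variable {X : Type*} {d : X → X → ℝ} {σ : X → ℕ} {b D : ℝ}

theorem labelUltrametric_term_le (hd : IsMetric d) (hD : ∀ x y, d x y ≤ D) (x y : X) (k : ℤ) :
    (if ballLabel d σ (b * 2 ^ k) x = ballLabel d σ (b * 2 ^ k) y then 0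
      else 4 * (b * 2 ^ k)) ≤ 4 * D := by
  split_ifs with h
  · linarith [hd.1 x y, hD x y]
  · linarith [lt_of_ballLabel_ne hD h]

theorem labelUltrametric_le (hd : IsMetric d) (hD : ∀ x y, d x y ≤ D) (x y : X) :
    labelUltrametric d σ b x y ≤ 4 * D :=
  ciSup_le (labelUltrametric_term_le hd hD x y)

theorem bddAbove_labelUltrametric (hd : IsMetric d) (hD : ∀ x y, d x y ≤ D) (x y : X) :
    BddAbove (Set.range fun k : ℤ =>
      if ballLabel d σ (b * 2 ^ k) x = ballLabel d σ (b * 2 ^ k) y then 0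
        else 4 * (b * 2 ^ k)) :=
  ⟨4 * D, by rintro _ ⟨k, rfl⟩; exact labelUltrametric_term_le hd hD x y k⟩

theorem labelUltrametric_nonneg (hb : 0 < b) (x y : X) : 0 ≤ labelUltrametric d σ b x y :=
  Real.iSup_nonneg fun k => by split_ifs <;> positivity

theorem labelUltrametric_self (x : X) : labelUltrametric d σ b x x = 0 := by
  simp [labelUltrametric]

theorem labelUltrametric_comm (x y : X) :
    labelUltrametric d σ b x y = labelUltrametric d σ b y x := by
  simp only [labelUltrametric, eq_comm]

theorem le_labelUltrametric (hd : IsMetric d) (hD : ∀ x y, d x y ≤ D)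
    (hσ : Function.Injective σ) (hb : 0 < b) (x y : X) : d x y ≤ labelUltrametric d σ b x y := by
  rcases eq_or_ne x y with rfl | hxy
  · rw [(hd.2.1 x x).2 rfl, labelUltrametric_self]
  have hpos : 0 < d x y := (hd.1 x y).lt_of_ne' fun h => hxy ((hd.2.1 x y).1 h)
  obtain ⟨k, hk1, hk2⟩ := exists_mem_Ioc_zpow (x := d x y / (2 * b)) (y := (2 : ℝ))
    (by positivity) one_lt_two
  rw [lt_div_iff₀ (by positivity)] at hk1
  rw [div_le_iff₀ (by positivity), zpow_add_one₀ two_ne_zero] at hk2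
  have hr : 0 < b * 2 ^ k := by positivity
  have hne : ballLabel d σ (b * 2 ^ k) x ≠ ballLabel d σ (b * 2 ^ k) y := by
    intro h
    obtain ⟨u, hu, hu'⟩ := exists_ballLabel_eq hd σ hr.le x
    obtain ⟨v, hv, hv'⟩ := exists_ballLabel_eq hd σ hr.le y
    obtain rfl : u = v := hσ (by rw [hu', hv', h])
    have := hd.2.2.2 x u y
    rw [hd.2.2.1 u y] at this
    linarith
  have := le_ciSup (bddAbove_labelUltrametric (σ := σ) (b := b) hd hD x y) k
  rw [if_neg hne] at this
  refine le_trans ?_ this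
  linarith

theorem isUltrametric_labelUltrametric (hd : IsMetric d) (hD : ∀ x y, d x y ≤ D) (hb : 0 < b) :
    IsUltrametric (labelUltrametric d σ b) := by
  intro u v w
  refine ciSup_le fun k => ?_
  have h1 := le_ciSup (bddAbove_labelUltrametric (σ := σ) (b := b) hd hD u w) k
  have h2 := le_ciSup (bddAbove_labelUltrametric (σ := σ) (b := b) hd hD w v) k
  have h0 := labelUltrametric_nonneg (d := d) (σ := σ) hb u w
  split_ifs with h
  · exact le_max_of_le_left h0
  by_cases huw : ballLabel d σ (b * 2 ^ k) u = ballLabel d σ (b * 2 ^ k) w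
  · rw [if_neg fun hwv => h (huw.trans hwv)] at h2
    exact le_max_of_le_right h2
  · rw [if_neg huw] at h1
    exact le_max_of_le_left h1

theorem isMetric_labelUltrametric (hd : IsMetric d) (hD : ∀ x y, d x y ≤ D)
    (hσ : Function.Injective σ) (hb : 0 < b) : IsMetric (labelUltrametric d σ b) := by
  have h0 := labelUltrametric_nonneg (d := d) (σ := σ) hb
  refine ⟨h0, fun x y => ⟨fun h => ?_, ?_⟩, labelUltrametric_comm, fun x y z => ?_⟩
  · exact (hd.2.1 x y).1 (le_antisymm (h ▸ le_labelUltrametric hd hD hσ hb x y) (hd.1 x y))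
  · rintro rfl
    exact labelUltrametric_self x
  · exact (isUltrametric_labelUltrametric hd hD hb x z y).trans
      (max_le_add_of_nonneg (h0 x y) (h0 y z))

/-- If the gradient at `x` exceeds `4 / δ`, then at some scale `r` the minimally labelled point of
the ball of radius `r * (1 + δ)` around `x` lies close to the sphere of radius `r`. -/
theorem exists_minimal_label_near_sphere (hd : IsMetric d) (hb : 0 < b) {x y : X} {δ : ℝ}
    (hδ : 0 < δ) (hxy : 4 / δ * d x y < labelUltrametric d σ b x y) :
    ∃ z, (∀ w, d x w ≤ d x z → σ z ≤ σ w) ∧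
      ∃ k : ℤ, b * 2 ^ k * (1 - δ) < d x z ∧ d x z ≤ b * 2 ^ k * (1 + δ) := by
  obtain ⟨k, hk⟩ := exists_lt_of_lt_ciSup hxy
  have h0 : 0 ≤ 4 / δ * d x y := mul_nonneg (by positivity) (hd.1 x y)
  split_ifs at hk with h
  · exact absurd hk h0.not_gt
  set r := b * 2 ^ k with hr_def
  have hr : 0 < r := by positivity
  have hclose : d x y < r * δ := by
    rw [div_mul_eq_mul_div, div_lt_iff₀ hδ] at hk
    linarith
  obtain ⟨z, hz, hzl⟩ := exists_ballLabel_eq hd σ (r := r * (1 + δ)) (by positivity) x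
  refine ⟨z, fun w hw => hzl ▸ ballLabel_le d σ (hw.trans hz), k, ?_, hz⟩
  by_contra! hzr
  have hlabel : ∀ u, d x u < r * δ → ballLabel d σ r u = σ z := by
    intro u hu
    apply le_antisymm
    · refine ballLabel_le d σ ?_
      have := hd.2.2.2 u x z
      rw [hd.2.2.1 u x] at this
      linarith
    · obtain ⟨w, hw, hwl⟩ := exists_ballLabel_eq hd σ hr.le u
      rw [← hwl, hzl]
      refine ballLabel_le d σ ?_
      linarith [hd.2.2.2 x u w]
  refine h ((hlabel x ?_).trans (hlabel y hclose).symm)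
  rw [(hd.2.1 x x).2 rfl]
  positivity

end LabelUltrametric

theorem card_filter_minimal_mul_card_le {X : Type*} [Fintype X] [DecidableEq X] {n : ℕ}
    (S : Finset X) {z : X} (hz : z ∈ S) :
    (Finset.univ.filter fun σ : X ≃ Fin n => ∀ w ∈ S, σ z ≤ σ w).card * S.card ≤
      Fintype.card (X ≃ Fin n) := by
  let A : X → Finset (X ≃ Fin n) := fun u => Finset.univ.filter fun σ => ∀ w ∈ S, σ u ≤ σ w
  have hle : ∀ u ∈ S, (A z).card ≤ (A u).card := by
    intro u hu
    refine Finset.card_le_card_of_injOn (fun σ => (Equiv.swap z u).trans σ) ?_ ?_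
    · intro σ hσ
      simp only [A, Finset.coe_filter, Finset.mem_univ, true_and, Set.mem_ofPred_eq] at hσ ⊢
      intro w hw
      simp only [Equiv.trans_apply, Equiv.swap_apply_right]
      refine hσ _ ?_
      rcases eq_or_ne w z with rfl | hwz
      · simpa using hu
      · rcases eq_or_ne w u with rfl | hwu
        · simpa using hz
        · rwa [Equiv.swap_apply_of_ne_of_ne hwz hwu]
    · intro σ _ τ _ h
      ext w
      have := congrArg (fun e : X ≃ Fin n => e (Equiv.swap z u w)) h
      simpa using congrArg Fin.val this
  have hdisj : (S : Set X).PairwiseDisjoint A := by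
    intro u hu v hv huv
    refine Finset.disjoint_left.2 fun σ hσu hσv => huv ?_
    simp only [A, Finset.mem_filter, Finset.mem_univ, true_and] at hσu hσv
    exact σ.injective (le_antisymm (hσu v hv) (hσv u hu))
  calc (A z).card * S.card = ∑ _u ∈ S, (A z).card := by rw [Finset.sum_const, smul_eq_mul, mul_comm]
    _ ≤ ∑ u ∈ S, (A u).card := Finset.sum_le_sum hle
    _ = (S.biUnion A).card := (Finset.card_biUnion hdisj).symm
    _ ≤ _ := Finset.card_le_univ _

theorem sum_inv_card_filter_le_harmonic {X : Type*} (f : X → ℝ) (S : Finset X) :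
    ∑ z ∈ S, ((S.filter fun w => f w ≤ f z).card : ℚ)⁻¹ ≤ harmonic S.card := by
  classical
  refine Finset.induction_on_max_value f S (by simp) fun a s ha hmax ih => ?_
  · rw [Finset.sum_insert ha, Finset.card_insert_of_notMem ha, harmonic_succ, add_comm]
    refine add_le_add ((Finset.sum_le_sum fun z hz => ?_).trans ih) ?_
    · have hpos : 0 < (s.filter fun w => f w ≤ f z).card :=
        Finset.card_pos.2 ⟨z, Finset.mem_filter.2 ⟨hz, le_rfl⟩⟩
      gcongr
      exact Finset.subset_insert a s
    · rw [Finset.filter_true_of_mem, Finset.card_insert_of_notMem ha]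
      intro w hw
      rcases Finset.mem_insert.1 hw with rfl | hw
      exacts [le_rfl, hmax w hw]

open Classical in
theorem card_filter_exists_scale_mem_Icc_le {N : ℕ} (hN : 0 < N) {A B : ℝ} (hA : 0 < A)
    (hAB : A ≤ B) :
    ((Finset.univ.filter fun j : Fin N => ∃ k : ℤ,
      A ≤ (2 : ℝ) ^ ((j : ℝ) / N) * 2 ^ k ∧ (2 : ℝ) ^ ((j : ℝ) / N) * 2 ^ k ≤ B).card : ℝ) ≤
      N * Real.logb 2 (B / A) + 1 := by
  classical
  set F := Finset.univ.filter fun j : Fin N => ∃ k : ℤ,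
      A ≤ (2 : ℝ) ^ ((j : ℝ) / N) * 2 ^ k ∧ (2 : ℝ) ^ ((j : ℝ) / N) * 2 ^ k ≤ B
  have hB : 0 < B := hA.trans_le hAB
  have hN' : (0 : ℝ) < N := Nat.cast_pos.2 hN
  set u := N * Real.logb 2 A with hu
  set v := N * Real.logb 2 B with hv
  have huv : u ≤ v := by
    have := Real.logb_le_logb_of_le one_lt_two hA hAB
    rw [hu, hv]; gcongr
  have hsub : F.image (fun j : Fin N => (j : ℤ)) ⊆
      (Finset.Icc ⌈u⌉ ⌊v⌋).image (fun a => a % (N : ℤ)) := by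
    intro a ha
    obtain ⟨j, hj, rfl⟩ := Finset.mem_image.1 ha
    obtain ⟨k, hk1, hk2⟩ := (Finset.mem_filter.1 hj).2
    have hlog : Real.logb 2 ((2 : ℝ) ^ ((j : ℝ) / N) * 2 ^ k) = (j : ℝ) / N + k := by
      rw [← Real.rpow_intCast, ← Real.rpow_add two_pos,
        Real.logb_rpow two_pos (by norm_num)]
    have h1 := Real.logb_le_logb_of_le one_lt_two hA hk1
    have h2 := Real.logb_le_logb_of_le one_lt_two (by positivity) hk2
    rw [hlog] at h1 h2
    have hmul : (N : ℝ) * ((j : ℝ) / N + k) = j + k * N := by field_simp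
    refine Finset.mem_image.2 ⟨(j : ℤ) + k * N, Finset.mem_Icc.2 ⟨?_, ?_⟩, ?_⟩
    · rw [Int.ceil_le]; push_cast; rw [← hmul, hu]; gcongr
    · rw [Int.le_floor]; push_cast; rw [← hmul, hv]; gcongr
    · simp only [Int.add_mul_emod_self_right]
      exact Int.emod_eq_of_lt (by positivity) (by exact_mod_cast j.2)
  have hcard : F.card ≤ (Finset.Icc ⌈u⌉ ⌊v⌋).card := by
    rw [← Finset.card_image_of_injective F
      (f := fun j : Fin N => (j : ℤ)) (fun i j h => Fin.ext (Int.ofNat.inj h))]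
    exact (Finset.card_le_card hsub).trans Finset.card_image_le
  have hIcc : ((Finset.Icc ⌈u⌉ ⌊v⌋).card : ℝ) ≤ v - u + 1 := by
    rw [Int.card_Icc]
    rcases le_total 0 (⌊v⌋ + 1 - ⌈u⌉) with h | h
    · have hcast : (((⌊v⌋ + 1 - ⌈u⌉).toNat : ℤ) : ℝ) = ((⌊v⌋ + 1 - ⌈u⌉ : ℤ) : ℝ) := by
        rw [Int.toNat_of_nonneg h]
      rw [Int.cast_natCast] at hcast
      rw [hcast]; push_cast
      linarith [Int.floor_le v, Int.le_ceil u]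
    · rw [Int.toNat_of_nonpos h]; push_cast; linarith
  calc (F.card : ℝ) ≤ _ := Nat.cast_le.2 hcard
    _ ≤ v - u + 1 := hIcc
    _ = _ := by rw [Real.logb_div hB.ne' hA.ne', hu, hv]; ring

theorem logb_two_one_add_div_one_sub_le {δ : ℝ} (hδ : 0 < δ) (hδ' : δ ≤ 1 / 2) :
    Real.logb 2 ((1 + δ) / (1 - δ)) ≤ 6 * δ := by
  have hlog2 := Real.log_two_gt_d9
  have h1 : 0 < 1 - δ := by linarith
  rw [Real.logb, div_le_iff₀ (by linarith)]
  calc Real.log ((1 + δ) / (1 - δ)) ≤ (1 + δ) / (1 - δ) - 1 :=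
        Real.log_le_sub_one_of_pos (by positivity)
    _ ≤ 4 * δ := by
        rw [sub_le_iff_le_add, div_le_iff₀ h1]
        nlinarith
    _ ≤ 6 * δ * Real.log 2 := by nlinarith

open Classical in
/-- The proportion of pairs `(σ, j)` for which the gradient at `x` of the associated ultrametric
exceeds `t` is `O(log n / t)`. -/
theorem card_filter_lt_gradient_le {X : Type*} [Fintype X] {d : X → X → ℝ} (hd : IsMetric d)
    {n N : ℕ} (hn : Fintype.card X = n) (hN : 0 < N) (x : X) {t : ℝ} (ht : 0 < t)
    (htN : t ≤ 4 * N) :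
    ((Finset.univ.filter fun q : (X ≃ Fin n) × Fin N => ∃ y,
      t * d x y < labelUltrametric d (fun w => (q.1 w : ℕ)) (2 ^ ((q.2 : ℝ) / N)) x y).card : ℝ) ≤
      28 * (1 + Real.log n) / t * Fintype.card ((X ≃ Fin n) × Fin N) := by
  classical
  have hlogn : 0 ≤ Real.log n := Real.log_natCast_nonneg n
  rcases lt_or_ge t 8 with ht8 | ht8
  · calc _ ≤ (Fintype.card ((X ≃ Fin n) × Fin N) : ℝ) := Nat.cast_le.2 (Finset.card_le_univ _)
      _ ≤ _ := le_mul_of_one_le_left (by positivity) (by rw [le_div_iff₀ ht]; linarith)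
  set δ := 4 / t with hδ_def
  have hδ : 0 < δ := by positivity
  have hδ' : δ ≤ 1 / 2 := by rw [hδ_def, div_le_iff₀ ht]; linarith
  have htδ : 4 / δ = t := by rw [hδ_def]; field_simp
  let P : X → Finset (X ≃ Fin n) := fun z =>
    Finset.univ.filter fun σ => ∀ w ∈ Finset.univ.filter (fun w => d x w ≤ d x z), σ z ≤ σ w
  let Q : X → Finset (Fin N) := fun z => Finset.univ.filter fun j : Fin N =>
    ∃ k : ℤ, (2 : ℝ) ^ ((j : ℝ) / N) * 2 ^ k * (1 - δ) < d x z ∧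
      d x z ≤ (2 : ℝ) ^ ((j : ℝ) / N) * 2 ^ k * (1 + δ)
  have hsub : (Finset.univ.filter fun q : (X ≃ Fin n) × Fin N => ∃ y,
      t * d x y < labelUltrametric d (fun w => (q.1 w : ℕ)) (2 ^ ((q.2 : ℝ) / N)) x y) ⊆
      Finset.univ.biUnion fun z => P z ×ˢ Q z := by
    rintro ⟨σ, j⟩ hq
    obtain ⟨y, hy⟩ := (Finset.mem_filter.1 hq).2
    rw [← htδ] at hy
    obtain ⟨z, hz, hk⟩ := exists_minimal_label_near_sphere hd (by positivity) hδ hy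
    simp only [P, Q, Finset.mem_biUnion, Finset.mem_univ, true_and, Finset.mem_product,
      Finset.mem_filter]
    exact ⟨z, fun w hw => Fin.le_def.2 (hz w hw), hk⟩
  have hP : ∀ z, ((P z).card : ℝ) ≤
      ((Finset.univ.filter fun w => d x w ≤ d x z).card : ℝ)⁻¹ * Fintype.card (X ≃ Fin n) := by
    intro z
    have hz : z ∈ Finset.univ.filter fun w => d x w ≤ d x z := by simp
    have h := card_filter_minimal_mul_card_le (n := n) _ hz
    have hpos : (0 : ℝ) < (Finset.univ.filter fun w => d x w ≤ d x z).card :=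
      Nat.cast_pos.2 (Finset.card_pos.2 ⟨z, hz⟩)
    rw [inv_mul_eq_div, le_div_iff₀ hpos]
    exact_mod_cast h
  have hQ : ∀ z, ((Q z).card : ℝ) ≤ 7 * δ * N := by
    intro z
    rcases (hd.1 x z).eq_or_lt with h0 | h0
    · have hempty : Q z = ∅ := by
        refine Finset.filter_eq_empty_iff.2 fun j _ => ?_
        rintro ⟨k, hk, -⟩
        rw [← h0] at hk
        have : 0 ≤ (2 : ℝ) ^ ((j : ℝ) / N) * 2 ^ k * (1 - δ) :=
          mul_nonneg (by positivity) (by linarith)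
        linarith
      rw [hempty]; simp only [Finset.card_empty, Nat.cast_zero]; positivity
    have hδ1 : 0 < 1 - δ := by linarith
    have hratio : d x z / (1 - δ) / (d x z / (1 + δ)) = (1 + δ) / (1 - δ) := by field_simp
    have hcount := card_filter_exists_scale_mem_Icc_le hN
      (A := d x z / (1 + δ)) (B := d x z / (1 - δ)) (by positivity) (by gcongr; linarith)
    rw [hratio] at hcount
    have hNδ : 1 ≤ δ * N := by
      rw [hδ_def, div_mul_eq_mul_div, le_div_iff₀ ht]; linarith
    have hQle : (Q z).card ≤ (Finset.univ.filter fun j : Fin N => ∃ k : ℤ,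
        d x z / (1 + δ) ≤ (2 : ℝ) ^ ((j : ℝ) / N) * 2 ^ k ∧
        (2 : ℝ) ^ ((j : ℝ) / N) * 2 ^ k ≤ d x z / (1 - δ)).card := by
      refine Finset.card_le_card (Finset.monotone_filter_right _ ?_)
      rintro j - ⟨k, hk1, hk2⟩
      exact ⟨k, (div_le_iff₀ (by positivity)).2 hk2, (le_div_iff₀ hδ1).2 hk1.le⟩
    calc ((Q z).card : ℝ) ≤ _ := Nat.cast_le.2 hQle
      _ ≤ N * Real.logb 2 ((1 + δ) / (1 - δ)) + 1 := hcount
      _ ≤ N * (6 * δ) + δ * N := by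
          gcongr
          exact logb_two_one_add_div_one_sub_le hδ hδ'
      _ = 7 * δ * N := by ring
  have hharm : ∑ z, ((Finset.univ.filter fun w => d x w ≤ d x z).card : ℝ)⁻¹ ≤
      1 + Real.log n := by
    have h := sum_inv_card_filter_le_harmonic (d x) Finset.univ
    rw [Finset.card_univ, hn] at h
    calc _ = ((∑ z, ((Finset.univ.filter fun w => d x w ≤ d x z).card : ℚ)⁻¹ : ℚ) : ℝ) := by
          push_cast; rfl
      _ ≤ (harmonic n : ℝ) := Rat.cast_le.2 h
      _ ≤ _ := harmonic_le_one_add_log n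
  calc _ ≤ (((Finset.univ.biUnion fun z => P z ×ˢ Q z).card : ℕ) : ℝ) :=
        Nat.cast_le.2 (Finset.card_le_card hsub)
    _ ≤ ((∑ z, (P z ×ˢ Q z).card : ℕ) : ℝ) := Nat.cast_le.2 Finset.card_biUnion_le
    _ = ∑ z, ((P z).card : ℝ) * (Q z).card := by simp [Finset.card_product]
    _ ≤ ∑ z, ((Finset.univ.filter fun w => d x w ≤ d x z).card : ℝ)⁻¹ *
          Fintype.card (X ≃ Fin n) * (7 * δ * N) := by
        gcongr with z
        exacts [hP z, hQ z]
    _ = (∑ z, ((Finset.univ.filter fun w => d x w ≤ d x z).card : ℝ)⁻¹) *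
          (Fintype.card (X ≃ Fin n) * (7 * δ * N)) := by
        rw [Finset.sum_mul]; exact Finset.sum_congr rfl fun z _ => by ring
    _ ≤ (1 + Real.log n) * (Fintype.card (X ≃ Fin n) * (7 * δ * N)) := by gcongr
    _ = _ := by
        rw [Fintype.card_prod, Fintype.card_fin, hδ_def]; push_cast; ring

theorem le_one_add_sum_two_pow_indicator {g : ℝ} {L : ℕ} (hg : g ≤ 2 ^ L) :
    g ≤ 1 + ∑ i ∈ Finset.range L, if (2 : ℝ) ^ i < g then (2 : ℝ) ^ i else 0 := by
  induction L with
  | zero => simpa using hg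
  | succ L ih =>
    rcases le_or_gt g (2 ^ L) with h | h
    · rw [Finset.sum_range_succ, if_neg h.not_gt, add_zero]
      exact ih h
    · have hall : ∀ i ∈ Finset.range (L + 1),
          (if (2 : ℝ) ^ i < g then (2 : ℝ) ^ i else 0) = 2 ^ i := by
        intro i hi
        refine if_pos (lt_of_le_of_lt ?_ h)
        exact pow_le_pow_right₀ one_le_two (Nat.lt_succ_iff.1 (Finset.mem_range.1 hi))
      rw [Finset.sum_congr rfl hall, geom_sum_eq (by norm_num)]
      linarith

/-- A finite average is controlled by its upper tails at powers of two. -/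
theorem sum_le_of_dyadic_tail {Ω : Type*} [Fintype Ω] (g : Ω → ℝ) {L : ℕ} {K : ℝ}
    (hg : ∀ q, g q ≤ 2 ^ L)
    (htail : ∀ i < L, ((Finset.univ.filter fun q => (2 : ℝ) ^ i < g q).card : ℝ) ≤
      K / 2 ^ i * Fintype.card Ω) :
    ∑ q, g q ≤ (1 + L * K) * Fintype.card Ω := by
  calc ∑ q, g q ≤ ∑ q, (1 + ∑ i ∈ Finset.range L, if (2 : ℝ) ^ i < g q then (2 : ℝ) ^ i else 0) :=
        Finset.sum_le_sum fun q _ => le_one_add_sum_two_pow_indicator (hg q)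
    _ = Fintype.card Ω + ∑ i ∈ Finset.range L,
          ((Finset.univ.filter fun q => (2 : ℝ) ^ i < g q).card : ℝ) * 2 ^ i := by
        rw [Finset.sum_add_distrib, Finset.sum_comm]
        simp [← Finset.sum_filter]
    _ ≤ Fintype.card Ω + ∑ _i ∈ Finset.range L, K * Fintype.card Ω := by
        refine add_le_add_right (Finset.sum_le_sum fun i hi => ?_) _
        have h2 : (0 : ℝ) < 2 ^ i := by positivity
        calc _ ≤ K / 2 ^ i * Fintype.card Ω * 2 ^ i := by
              gcongr; exact htail i (Finset.mem_range.1 hi)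
          _ = _ := by field_simp
    _ = _ := by rw [Finset.sum_const, Finset.card_range, nsmul_eq_mul]; ring

/-- The averaged form of the embedding theorem, with the bound in terms of a dyadic bound for the
aspect ratio. -/
theorem exists_ultrametric_distribution {X : Type*} [Fintype X] {d : X → X → ℝ} (hd : IsMetric d)
    {n L : ℕ} (hn : Fintype.card X = n) (hn2 : 2 ≤ n) {D s : ℝ} (hs : 0 < s)
    (hD : ∀ x y, d x y ≤ D) (hmin : ∀ x y, x ≠ y → s ≤ d x y) (hL : 4 * (D / s) ≤ 2 ^ L) :
    ∃ (m : ℕ) (w : Fin m → ℝ) (ρ : Fin m → X → X → ℝ),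
      (∀ i, 0 ≤ w i) ∧ (∑ i, w i = 1) ∧
      (∀ i, w i ≠ 0 → IsMetric (ρ i) ∧ IsUltrametric (ρ i) ∧ ∀ x y, d x y ≤ ρ i x y) ∧
      (∀ x : X, ∑ i, w i * (⨆ y : {y : X // y ≠ x}, ρ i x y.1 / d x y.1) ≤
        1 + L * (28 * (1 + Real.log n))) := by
  classical
  have : Nontrivial X := Fintype.one_lt_card_iff_nontrivial.1 (by omega)
  let N := 2 ^ L
  have hN : 0 < N := by positivity
  let Ω := (X ≃ Fin n) × Fin N
  have hΩ : 0 < Fintype.card Ω :=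
    Fintype.card_pos_iff.2 ⟨(Fintype.equivFinOfCardEq hn, ⟨0, hN⟩)⟩
  have hΩ' : (0 : ℝ) < Fintype.card Ω := Nat.cast_pos.2 hΩ
  let ρ : Ω → X → X → ℝ := fun q =>
    labelUltrametric d (fun w => (q.1 w : ℕ)) (2 ^ ((q.2 : ℝ) / N))
  let e := Fintype.equivFin Ω
  have hb : ∀ q : Ω, (0 : ℝ) < 2 ^ ((q.2 : ℝ) / N) := fun q => by positivity
  have hinj : ∀ q : Ω, Function.Injective fun w => (q.1 w : ℕ) :=
    fun q => Fin.val_injective.comp q.1.injective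
  refine ⟨Fintype.card Ω, fun _ => (Fintype.card Ω : ℝ)⁻¹, fun i => ρ (e.symm i),
    fun _ => by positivity, by simp [hΩ.ne'], fun i _ => ⟨?_, ?_, ?_⟩, fun x => ?_⟩
  · exact isMetric_labelUltrametric hd hD (hinj _) (hb _)
  · exact isUltrametric_labelUltrametric hd hD (hb _)
  · exact le_labelUltrametric hd hD (hinj _) (hb _)
  have : Nonempty {y : X // y ≠ x} := let ⟨y, hy⟩ := exists_ne x; ⟨⟨y, hy⟩⟩
  have hpos : ∀ y : {y : X // y ≠ x}, 0 < d x y.1 := fun y => hs.trans_le (hmin _ _ y.2.symm)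
  rw [← Finset.mul_sum, Equiv.sum_comp e.symm fun q : Ω =>
    ⨆ y : {y : X // y ≠ x}, ρ q x y.1 / d x y.1, inv_mul_le_iff₀ hΩ', mul_comm]
  refine sum_le_of_dyadic_tail _ (fun q => ciSup_le fun y => ?_) fun i hi => ?_
  · refine le_trans ?_ hL
    have hD0 : 0 ≤ D := (hd.1 x x).trans (hD x x)
    rw [← mul_div_assoc]
    exact div_le_div₀ (by positivity) (labelUltrametric_le hd hD _ _) hs (hmin _ _ y.2.symm)
  · refine le_trans (Nat.cast_le.2 (Finset.card_le_card (Finset.monotone_filter_right _ ?_)))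
      (card_filter_lt_gradient_le hd hn hN x (by positivity) ?_)
    · intro q _ hq
      obtain ⟨y, hy⟩ := exists_lt_of_lt_ciSup hq
      exact ⟨y.1, (lt_div_iff₀ (hpos y)).1 hy⟩
    · have h1 : (2 : ℝ) ^ i ≤ 2 ^ L := pow_le_pow_right₀ one_le_two hi.le
      have h2 : (0 : ℝ) < 2 ^ L := by positivity
      simp only [N]
      push_cast
      linarith

theorem isMetric_discrete {X : Type*} [DecidableEq X] {D : ℝ} (hD : 0 < D) :
    IsMetric fun x y : X => if x = y then 0 else D := by
  refine ⟨fun x y => ?_, fun x y => ?_, fun x y => ?_, fun x y z => ?_⟩ <;> grind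

theorem isUltrametric_discrete {X : Type*} [DecidableEq X] {D : ℝ} (hD : 0 < D) :
    IsUltrametric fun x y : X => if x = y then 0 else D := by
  intro x y z
  grind

/-- Aspect-ratio version: there is a universal `C > 0` so that every `n`-point metric
space (`n ≥ 2`) admits a finitely supported distribution over dominating ultrametrics
whose expected maximum gradient at every point is `≤ C (1 + log n · log Φ(X))`, where
`Φ(X) = diam(X) / min positive distance` is the aspect ratio. -/
theorem maximum_gradient_aspect_ratio_bound :
    ∃ C : ℝ, 0 < C ∧
      ∀ (X : Type) [Fintype X] (d : X → X → ℝ) (n : ℕ),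
        Fintype.card X = n → 2 ≤ n → IsMetric d →
        ∃ (m : ℕ) (w : Fin m → ℝ) (ρ : Fin m → X → X → ℝ),
          (∀ i, 0 ≤ w i) ∧ (∑ i, w i = 1) ∧
          (∀ i, w i ≠ 0 →
            IsMetric (ρ i) ∧ IsUltrametric (ρ i) ∧ ∀ x y, d x y ≤ ρ i x y) ∧
          (∀ x : X,
            ∑ i, w i * (⨆ y : {y : X // y ≠ x}, ρ i x y.1 / d x y.1) ≤
              C * (1 + Real.log n *
                Real.log ((⨆ q : X × X, d q.1 q.2) /
                  (⨅ q : {q : X × X // q.1 ≠ q.2}, d q.1.1 q.1.2)))) := by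
  refine ⟨600, by norm_num, fun X _ d n hn hn2 hd => ?_⟩
  classical
  have : Nontrivial X := Fintype.one_lt_card_iff_nontrivial.1 (by omega)
  set D := ⨆ q : X × X, d q.1 q.2
  set s := ⨅ q : {q : X × X // q.1 ≠ q.2}, d q.1.1 q.1.2 with hs_def
  have hD : ∀ x y, d x y ≤ D := fun x y =>
    le_ciSup (f := fun q : X × X => d q.1 q.2) (Set.finite_range _).bddAbove (x, y)
  have hmin : ∀ x y, x ≠ y → s ≤ d x y := fun x y hxy =>
    ciInf_le (f := fun q : {q : X × X // q.1 ≠ q.2} => d q.1.1 q.1.2)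
      (Set.finite_range _).bddBelow ⟨(x, y), hxy⟩
  obtain ⟨a, b, hab⟩ := exists_pair_ne X
  have : Nonempty {q : X × X // q.1 ≠ q.2} := ⟨⟨(a, b), hab⟩⟩
  have hs : 0 < s := by
    obtain ⟨q, hq⟩ := exists_eq_ciInf_of_finite
      (f := fun q : {q : X × X // q.1 ≠ q.2} => d q.1.1 q.1.2)
    rw [hs_def, ← hq]
    exact (hd.1 _ _).lt_of_ne' fun h => q.2 ((hd.2.1 _ _).1 h)
  have hsD : s ≤ D := (hmin a b hab).trans (hD a b)
  have hD0 : 0 < D := hs.trans_le hsD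
  have hlog2 := Real.log_two_gt_d9
  have hlogn : Real.log 2 ≤ Real.log n :=
    Real.log_le_log two_pos (by exact_mod_cast hn2)
  rcases le_or_gt (D / s) 2 with hΦ | hΦ
  · refine ⟨1, fun _ => 1, fun _ x y => if x = y then 0 else D, fun _ => zero_le_one, by simp,
      fun _ _ => ⟨isMetric_discrete hD0, isUltrametric_discrete hD0, fun x y => ?_⟩, fun x => ?_⟩
    · beta_reduce
      split_ifs with h
      exacts [((hd.2.1 x y).2 h).le, hD x y]
    have : Nonempty {y : X // y ≠ x} := let ⟨y, hy⟩ := exists_ne x; ⟨⟨y, hy⟩⟩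
    have hlogΦ : 0 ≤ Real.log (D / s) := Real.log_nonneg ((one_le_div hs).2 hsD)
    have hgrad : (⨆ y : {y : X // y ≠ x}, (if x = y.1 then 0 else D) / d x y.1) ≤ 2 := by
      refine ciSup_le fun y => le_trans ?_ hΦ
      rw [if_neg y.2.symm]
      exact div_le_div_of_nonneg_left hD0.le hs (hmin _ _ y.2.symm)
    have hprod : 0 ≤ Real.log n * Real.log (D / s) := mul_nonneg (by linarith) hlogΦ
    simp only [Finset.univ_unique, Finset.sum_const, Finset.card_singleton, one_smul, one_mul]
    linarith
  · set Φ := D / s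
    have hlogΦ : Real.log 2 ≤ Real.log Φ := Real.log_le_log two_pos hΦ.le
    have hL : 4 * Φ ≤ 2 ^ ⌈Real.logb 2 (4 * Φ)⌉₊ := by
      have hle := Nat.le_ceil (Real.logb 2 (4 * Φ))
      rwa [Real.logb_le_iff_le_rpow one_lt_two (by positivity), Real.rpow_natCast] at hle
    obtain ⟨m, w, ρ, hw, hsum, hρ, hgrad⟩ :=
      exists_ultrametric_distribution hd hn hn2 hs hD hmin hL
    refine ⟨m, w, ρ, hw, hsum, hρ, fun x => (hgrad x).trans ?_⟩
    have hlog4 : Real.logb 2 (4 * Φ) * Real.log 2 = 2 * Real.log 2 + Real.log Φ := by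
      rw [Real.logb, div_mul_cancel₀ _ (by linarith), Real.log_mul (by norm_num) (by positivity),
        show (4 : ℝ) = 2 ^ 2 by norm_num, Real.log_pow]
      push_cast; rfl
    have hlogb : 0 ≤ Real.logb 2 (4 * Φ) := Real.logb_nonneg one_lt_two (by linarith)
    have hceil := (Nat.ceil_lt_add_one hlogb).le
    have hLle : (⌈Real.logb 2 (4 * Φ)⌉₊ : ℝ) ≤ 6 * Real.log Φ := by nlinarith
    have hK : 28 * (1 + Real.log n) ≤ 100 * Real.log n := by linarith
    have hmul := mul_le_mul hLle hK (by linarith) (by linarith)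
    linarith
end

section
/- There exists a universal constant c > 0 with the following property: for every N there exist n ≥ N and an n-point metric space (Y, d_Y) such that for every finitely supported probability distribution D over metrics ρ on Y with the property that each ρ in the support dominates d_Y and satisfies the four-point condition (i.e. is a tree metric), there exists a point x ∈ Y for which the expectation over D of max_{y ≠ x} ρ(x,y)/d_Y(x,y) is at least c·(log n)². -/
/-- `ρ` satisfies the four-point condition (tree metric). -/
def FourPointCond {X : Type*} (ρ : X → X → ℝ) : Prop :=
  ∀ w x y z, ρ w x + ρ y z ≤ max (ρ w y + ρ x z) (ρ w z + ρ x y)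

/-- `IsDiamond d m s t L`: in `(X, d)` there is a diamond graph of depth `m` with terminals `s`, `t`
and with `L` the list, with multiplicity, of the endpoints of its `4 ^ m` edges. Opposite quarters of
every subdiamond are separated by at least their diameter. -/
inductive IsDiamond {X : Type*} (d : X → X → ℝ) : ℕ → X → X → Multiset X → Prop
  | edge (s t : X) (h : d s t ≤ 1) : IsDiamond d 0 s t {s, t}
  | node {m : ℕ} {s t a b : X} {A₁ A₂ B₁ B₂ : Multiset X}
      (hA₁ : IsDiamond d m s a A₁) (hA₂ : IsDiamond d m a t A₂)
      (hB₁ : IsDiamond d m s b B₁) (hB₂ : IsDiamond d m b t B₂)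
      (h₁₂ : ∀ x ∈ A₁, ∀ y ∈ B₂, 2 ^ m ≤ d x y) (h₂₁ : ∀ x ∈ A₂, ∀ y ∈ B₁, 2 ^ m ≤ d x y) :
      IsDiamond d (m + 1) s t (A₁ + A₂ + B₁ + B₂)

namespace IsDiamond

variable {X Z : Type*} {d : X → X → ℝ} {m : ℕ} {s t : X} {L : Multiset X}

theorem card_eq (h : IsDiamond d m s t L) : L.card = 2 * 4 ^ m := by
  induction h with
  | edge s t h => simp
  | node hA₁ hA₂ hB₁ hB₂ h₁₂ h₂₁ i₁ i₂ i₃ i₄ =>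
    simp only [Multiset.card_add, i₁, i₂, i₃, i₄]
    ring

theorem terminals_mem (h : IsDiamond d m s t L) : s ∈ L ∧ t ∈ L := by
  induction h with
  | edge s t h => simp
  | node hA₁ hA₂ hB₁ hB₂ h₁₂ h₂₁ i₁ i₂ i₃ i₄ =>
    simp only [Multiset.mem_add]
    tauto

theorem dist_terminals_le (hd : IsMetric d) (h : IsDiamond d m s t L) :
    ∀ x ∈ L, d x s ≤ 2 ^ m ∧ d x t ≤ 2 ^ m := by
  obtain ⟨-, h0, hsymm, htri⟩ := hd
  induction h with
  | edge s t h =>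
    have hs := (h0 s s).2 rfl
    have ht := (h0 t t).2 rfl
    have := hsymm s t
    intro x hx
    simp only [Multiset.insert_eq_cons, Multiset.mem_cons, Multiset.mem_singleton] at hx
    rcases hx with rfl | rfl <;> constructor <;> norm_num <;> linarith
  | @node m s t a b A₁ A₂ B₁ B₂ hA₁ hA₂ hB₁ hB₂ h₁₂ h₂₁ i₁ i₂ i₃ i₄ =>
    have e₁ := (i₁ a hA₁.terminals_mem.2).1
    have e₂ := (i₂ a hA₂.terminals_mem.1).2
    have e₃ := (i₃ b hB₁.terminals_mem.2).1
    have e₄ := (i₄ b hB₂.terminals_mem.1).2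
    have hp : (2 : ℝ) ^ (m + 1) = 2 ^ m + 2 ^ m := by ring
    have h2 : (0 : ℝ) < 2 ^ m := by positivity
    intro x hx
    simp only [Multiset.mem_add] at hx
    rw [hp]
    rcases hx with ((hx | hx) | hx) | hx
    · have := i₁ x hx
      constructor <;> linarith [htri x a t]
    · have := i₂ x hx
      constructor <;> linarith [htri x a s]
    · have := i₃ x hx
      constructor <;> linarith [htri x b t]
    · have := i₄ x hx
      constructor <;> linarith [htri x b s]

theorem map {d' : Z → Z → ℝ} (f : X → Z) (h : IsDiamond d m s t L)
    (hf : ∀ x ∈ L, ∀ y ∈ L, d' (f x) (f y) = d x y) :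
    IsDiamond d' m (f s) (f t) (L.map f) := by
  induction h with
  | edge s t h =>
    have := hf s (by simp) t (by simp)
    simpa using IsDiamond.edge (d := d') (f s) (f t) (by linarith)
  | node hA₁ hA₂ hB₁ hB₂ h₁₂ h₂₁ i₁ i₂ i₃ i₄ =>
    simp only [Multiset.mem_add] at hf
    simp only [Multiset.map_add]
    refine .node (i₁ fun x hx y hy => hf x (by simp [hx]) y (by simp [hy]))
      (i₂ fun x hx y hy => hf x (by simp [hx]) y (by simp [hy]))
      (i₃ fun x hx y hy => hf x (by simp [hx]) y (by simp [hy]))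
      (i₄ fun x hx y hy => hf x (by simp [hx]) y (by simp [hy])) ?_ ?_
    · simp only [Multiset.mem_map]
      rintro _ ⟨x, hx, rfl⟩ _ ⟨y, hy, rfl⟩
      exact (h₁₂ x hx y hy).trans_eq (hf x (by simp [hx]) y (by simp [hy])).symm
    · simp only [Multiset.mem_map]
      rintro _ ⟨x, hx, rfl⟩ _ ⟨y, hy, rfl⟩
      exact (h₂₁ x hx y hy).trans_eq (hf x (by simp [hx]) y (by simp [hy])).symm

theorem two_pow_le_card_toFinset [DecidableEq X] (hd : ∀ x, d x x = 0)
    (h : IsDiamond d m s t L) : 2 ^ m ≤ L.toFinset.card := by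
  induction h with
  | edge s t h =>
    have : 0 < (({s, t} : Multiset X).toFinset).card := Finset.card_pos.2 ⟨s, by simp⟩
    exact this
  | @node m s t a b A₁ A₂ B₁ B₂ hA₁ hA₂ hB₁ hB₂ h₁₂ h₂₁ i₁ i₂ i₃ i₄ =>
    have hdisj : Disjoint A₁.toFinset B₂.toFinset := by
      refine Finset.disjoint_left.2 fun x hx hx' => ?_
      have := h₁₂ x (Multiset.mem_toFinset.1 hx) x (Multiset.mem_toFinset.1 hx')
      rw [hd] at this
      linarith [pow_pos (two_pos : (0 : ℝ) < 2) m]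
    calc 2 ^ (m + 1) ≤ A₁.toFinset.card + B₂.toFinset.card := by rw [pow_succ]; omega
      _ = (A₁.toFinset ∪ B₂.toFinset).card := (Finset.card_union_of_disjoint hdisj).symm
      _ ≤ _ := Finset.card_le_card fun x hx => by
        simp only [Finset.mem_union, Multiset.mem_toFinset, Multiset.mem_add] at hx ⊢
        tauto

end IsDiamond

/-- Diamonds of every depth exist. The function `f` is the height above the terminal `s`. -/
theorem exists_isDiamond (m : ℕ) :
    ∃ (X : Type) (_ : MetricSpace X) (f : X → ℝ) (s t : X) (L : Multiset X),
      (∀ x y, |f x - f y| ≤ dist x y) ∧ f s = 0 ∧ f t = 2 ^ m ∧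
        IsDiamond (dist : X → X → ℝ) m s t L := by
  induction m with
  | zero =>
    exact ⟨ℝ, inferInstance, id, 0, 1, {0, 1}, fun x y => le_of_eq (Real.dist_eq x y).symm,
      rfl, by simp, .edge 0 1 (by simp)⟩
  | succ m ih =>
    obtain ⟨X, _, f, s, t, L, hf, hs, ht, hL⟩ := ih
    let α₁ : X → X × X × ℝ × ℝ × ℝ := fun x => (x, s, f x, 0, f x)
    let α₂ : X → X × X × ℝ × ℝ × ℝ := fun x => (t, x, 2 ^ m + f x, f x, 2 ^ m)
    let β₁ : X → X × X × ℝ × ℝ × ℝ := fun x => (x, s, f x, f x, 0)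
    let β₂ : X → X × X × ℝ × ℝ × ℝ := fun x => (t, x, 2 ^ m + f x, 2 ^ m, f x)
    have hA₁ := hL.map (d' := dist) α₁ fun x _ y _ => by
      simp [α₁, Prod.dist_eq, Real.dist_eq, hf x y]
    have hA₂ := hL.map (d' := dist) α₂ fun x _ y _ => by
      simp [α₂, Prod.dist_eq, Real.dist_eq, hf x y]
    have hB₁ := hL.map (d' := dist) β₁ fun x _ y _ => by
      simp [β₁, Prod.dist_eq, Real.dist_eq, hf x y]
    have hB₂ := hL.map (d' := dist) β₂ fun x _ y _ => by
      simp [β₂, Prod.dist_eq, Real.dist_eq, hf x y]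
    rw [show α₂ s = α₁ t by simp [α₁, α₂, hs, ht]] at hA₂
    rw [show β₁ s = α₁ s by simp [α₁, β₁, hs]] at hB₁
    rw [show β₂ s = β₁ t by simp [β₁, β₂, hs, ht], show β₂ t = α₂ t by simp [α₂, β₂, ht]] at hB₂
    refine ⟨_, inferInstance, fun x => x.2.2.1, α₁ s, α₂ t, _, fun x y => ?_, hs, ?_,
      .node hA₁ hA₂ hB₁ hB₂ ?_ ?_⟩
    · simp [Prod.dist_eq, Real.dist_eq]
    · simp only [α₂, ht]
      ring
    all_goals
      simp only [Multiset.mem_map]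
      rintro _ ⟨x, hx, rfl⟩ _ ⟨y, hy, rfl⟩
      simp [α₁, α₂, β₁, β₂, Prod.dist_eq, Real.dist_eq]

/-- In a tree metric, this says that the geodesics `[a, b]` and `[u, v]` intersect. -/
def Crosses {X : Type*} (ρ : X → X → ℝ) (a b u v : X) : Prop :=
  ρ a u + ρ b v ≤ ρ a b + ρ u v ∧ ρ a v + ρ b u ≤ ρ a b + ρ u v

section Tree

variable {X : Type*} {ρ : X → X → ℝ}

theorem Crosses.swap (hρ : IsMetric ρ) {a b u v : X} (h : Crosses ρ a b u v) :
    Crosses ρ u v a b := by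
  obtain ⟨h₁, h₂⟩ := h
  obtain ⟨-, -, hs, -⟩ := hρ
  rw [hs a u, hs b v] at h₁
  rw [hs a v, hs b u] at h₂
  constructor <;> linarith

theorem Crosses.split (hρ : IsMetric ρ) (h4 : FourPointCond ρ) {a b u v : X}
    (h : Crosses ρ a b u v) (c : X) : Crosses ρ a c u v ∨ Crosses ρ c b u v := by
  obtain ⟨h₁, h₂⟩ := h
  obtain ⟨-, -, hs, -⟩ := hρ
  have e₁ := h4 a u c v
  have e₂ := h4 a v c u
  have e₃ := h4 c u b v
  have e₄ := h4 c v b u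
  have e₅ := h4 a b c u
  have e₆ := h4 a b c v
  simp only [Crosses]
  simp only [hs u c, hs u b, hs v c, hs v b, hs v u, hs b c] at *
  grind

/-- Every geodesic that meets `[s, t]` meets some segment of length less than `T` with
endpoints in `L`. -/
def ShortlyLinked (ρ : X → X → ℝ) (T : ℝ) (s t : X) (L : Multiset X) : Prop :=
  ∀ u v, Crosses ρ s t u v → ∃ x ∈ L, ∃ y ∈ L, ρ x y < T ∧ Crosses ρ x y u v

theorem ShortlyLinked.trans (hρ : IsMetric ρ) (h4 : FourPointCond ρ) {T : ℝ} {s a t : X}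
    {A B L : Multiset X} (hA : ShortlyLinked ρ T s a A) (hB : ShortlyLinked ρ T a t B)
    (hAL : A ⊆ L) (hBL : B ⊆ L) : ShortlyLinked ρ T s t L := by
  intro u v h
  rcases h.split hρ h4 a with h | h
  · obtain ⟨x, hx, y, hy, hxy⟩ := hA u v h
    exact ⟨x, hAL hx, y, hAL hy, hxy⟩
  · obtain ⟨x, hx, y, hy, hxy⟩ := hB u v h
    exact ⟨x, hBL hx, y, hBL hy, hxy⟩

theorem ShortlyLinked.not_crosses (hρ : IsMetric ρ) {T : ℝ} {s t u v : X} {A B : Multiset X}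
    (hA : ShortlyLinked ρ T s t A) (hB : ShortlyLinked ρ T u v B)
    (hsep : ∀ x ∈ A, ∀ y ∈ B, T ≤ ρ x y) : ¬ Crosses ρ s t u v := by
  intro h
  obtain ⟨x, hx, y, hy, hxy, h⟩ := hA u v h
  obtain ⟨z, hz, w, hw, hzw, h⟩ := hB x y (h.swap hρ)
  have h₁ := hsep x hx z hz
  have h₂ := hsep y hy w hw
  have := (h.swap hρ).1
  linarith

theorem crosses_or_crosses (hρ : IsMetric ρ) (h4 : FourPointCond ρ) (s a t b : X) :
    Crosses ρ s a b t ∨ Crosses ρ a t s b := by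
  obtain ⟨-, -, hs, -⟩ := hρ
  have e := h4 s t a b
  simp only [Crosses]
  simp only [hs a s, hs t b, hs t s, hs t a] at *
  grind

end Tree

/-- A diamond of depth `m` has, in a dominating tree metric, a proportion of at least
`(m - q) 2 ^ (- q) / 12` of points of gradient at least `2 ^ (q - 1)`, and this proportion is larger
when the diamond is disconnected at the scale of its subdiamonds of depth `m - p`. -/
theorem IsDiamond.le_sum_and {X : Type*} {d ρ : X → X → ℝ} (hd : IsMetric d) (hρ : IsMetric ρ)
    (h4 : FourPointCond ρ) (hdom : ∀ x y, d x y ≤ ρ x y) {q K : ℕ} (hK : K ≤ 2 ^ q) {φ : X → ℝ}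
    (hφ0 : ∀ x, 0 ≤ φ x)
    (hφ1 : ∀ x y, 0 < ρ x y → 2 ^ q * d x y ≤ 2 * ρ x y → 1 ≤ φ x)
    {m : ℕ} {s t : X} {L : Multiset X} (h : IsDiamond d m s t L) (hm : m ≤ K) :
    2 * 4 ^ m * ((1 / 2 : ℝ) ^ q / 12 * (m - q)) ≤ (L.map φ).sum ∧
      ∀ p r : ℕ, m = r + p → ShortlyLinked ρ (2 ^ q * 2 ^ r) s t L ∨
        2 * 4 ^ m * ((1 / 2 : ℝ) ^ q / 12 * (m - q) - 2 * ((1 / 2 : ℝ) ^ q / 12)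
          + (1 / 2) ^ (p + 1)) ≤ (L.map φ).sum := by
  have hε : (0 : ℝ) < (1 / 2 : ℝ) ^ q / 12 := by positivity
  have hnonneg : ∀ L : Multiset X, 0 ≤ (L.map φ).sum := fun L =>
    Multiset.sum_nonneg fun y hy => by
      obtain ⟨x, -, rfl⟩ := Multiset.mem_map.1 hy
      exact hφ0 x
  have htop : ∀ {m : ℕ} {s t : X} {L : Multiset X}, IsDiamond d m s t L → m ≤ K →
      ShortlyLinked ρ (2 ^ q * 2 ^ m) s t L ∨
        2 * 4 ^ m * ((1 / 2 : ℝ) ^ q / 12 * (m - q) - 2 * ((1 / 2 : ℝ) ^ q / 12)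
          + (1 / 2) ^ (0 + 1)) ≤ (L.map φ).sum := by
    intro m s t L h hm
    by_cases hst : ρ s t < 2 ^ q * 2 ^ m
    · exact .inl fun u v huv => ⟨s, h.terminals_mem.1, t, h.terminals_mem.2, hst, huv⟩
    right
    push Not at hst
    have hpos : (0 : ℝ) < 2 ^ q * 2 ^ m := by positivity
    have h1 : ∀ x ∈ L, 1 ≤ φ x := by
      intro x hx
      obtain ⟨hxs, hxt⟩ := h.dist_terminals_le hd x hx
      have hxs' := mul_le_mul_of_nonneg_left hxs (by positivity : (0 : ℝ) ≤ 2 ^ q)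
      have hxt' := mul_le_mul_of_nonneg_left hxt (by positivity : (0 : ℝ) ≤ 2 ^ q)
      have htri := hρ.2.2.2 s x t
      rw [hρ.2.2.1 s x] at htri
      rcases le_total (2 ^ q * 2 ^ m) (2 * ρ x s) with h' | h'
      · exact hφ1 x s (by linarith) (by linarith)
      · exact hφ1 x t (by linarith) (by linarith)
    have hcard : (L.card : ℝ) ≤ (L.map φ).sum := by
      have := Multiset.sum_map_le_sum_map (s := L) (fun _ => (1 : ℝ)) φ h1
      simpa using this
    rw [h.card_eq] at hcard
    push_cast at hcard
    refine le_trans ?_ hcard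
    have hmq : (m : ℝ) ≤ 2 ^ q := by exact_mod_cast hm.trans hK
    have h2q : (1 / 2 : ℝ) ^ q * 2 ^ q = 1 := by rw [← mul_pow]; norm_num
    have : (1 / 2 : ℝ) ^ q / 12 * (m - q) ≤ 1 / 12 := by
      have := mul_le_mul_of_nonneg_left hmq hε.le
      have := mul_nonneg hε.le (Nat.cast_nonneg (α := ℝ) q)
      linarith
    refine mul_le_of_le_one_right (by positivity) ?_
    linarith
  induction h with
  | edge s t h =>
    refine ⟨(?_ : _ ≤ (0 : ℝ)).trans (hnonneg _), ?_⟩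
    · have := mul_nonneg hε.le (Nat.cast_nonneg (α := ℝ) q)
      simp only [pow_zero, Nat.cast_zero]
      linarith
    · intro p r hpr
      obtain ⟨rfl, rfl⟩ : r = 0 ∧ p = 0 := by omega
      exact htop (.edge s t h) hm
  | @node m s t a b A₁ A₂ B₁ B₂ hA₁ hA₂ hB₁ hB₂ h₁₂ h₂₁ i₁ i₂ i₃ i₄ =>
    obtain ⟨g₁, k₁⟩ := i₁ (by omega)
    obtain ⟨g₂, k₂⟩ := i₂ (by omega)
    obtain ⟨g₃, k₃⟩ := i₃ (by omega)
    obtain ⟨g₄, k₄⟩ := i₄ (by omega)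
    constructor
    · rcases lt_or_ge m q with hq | hq
      · refine le_trans (mul_nonpos_of_nonneg_of_nonpos (by positivity)
          (mul_nonpos_of_nonneg_of_nonpos hε.le ?_)) (hnonneg _)
        have : ((m + 1 : ℕ) : ℝ) ≤ q := by exact_mod_cast hq
        linarith
      obtain ⟨r, rfl⟩ : ∃ r, m = r + q := ⟨m - q, by omega⟩
      have hT : (2 : ℝ) ^ q * 2 ^ r = 2 ^ (r + q) := by ring
      have k₁ := k₁ q r rfl
      have k₂ := k₂ q r rfl
      have k₃ := k₃ q r rfl
      have k₄ := k₄ q r rfl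
      have hnot : ¬ (ShortlyLinked ρ (2 ^ q * 2 ^ r) s a A₁ ∧ ShortlyLinked ρ (2 ^ q * 2 ^ r) a t A₂ ∧
          ShortlyLinked ρ (2 ^ q * 2 ^ r) s b B₁ ∧ ShortlyLinked ρ (2 ^ q * 2 ^ r) b t B₂) := by
        rintro ⟨t₁, t₂, t₃, t₄⟩
        rw [hT] at t₁ t₂ t₃ t₄
        rcases crosses_or_crosses hρ h4 s a t b with hc | hc
        · exact t₁.not_crosses hρ t₄ (fun x hx y hy => (h₁₂ x hx y hy).trans (hdom x y)) hc
        · exact t₂.not_crosses hρ t₃ (fun x hx y hy => (h₂₁ x hx y hy).trans (hdom x y)) hc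
      simp only [Multiset.map_add, Multiset.sum_add]
      rw [pow_succ (1 / 2 : ℝ) q] at k₁ k₂ k₃ k₄
      rw [pow_succ (4 : ℝ), Nat.cast_succ]
      generalize ((r + q : ℕ) : ℝ) = z at *
      generalize (4 : ℝ) ^ (r + q) = M at *
      generalize (1 / 2 : ℝ) ^ q = e at *
      by_cases t₁ : ShortlyLinked ρ (2 ^ q * 2 ^ r) s a A₁
      · by_cases t₂ : ShortlyLinked ρ (2 ^ q * 2 ^ r) a t A₂
        · by_cases t₃ : ShortlyLinked ρ (2 ^ q * 2 ^ r) s b B₁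
          · have := k₄.resolve_left fun t₄ => hnot ⟨t₁, t₂, t₃, t₄⟩
            linarith
          · linarith [k₃.resolve_left t₃]
        · linarith [k₂.resolve_left t₂]
      · linarith [k₁.resolve_left t₁]
    · intro p r hpr
      rcases p with _ | p
      · obtain rfl : m + 1 = r := by omega
        exact htop (.node hA₁ hA₂ hB₁ hB₂ h₁₂ h₂₁) hm
      obtain rfl : m = r + p := by omega
      have k₁ := k₁ p r rfl
      have k₂ := k₂ p r rfl
      have k₃ := k₃ p r rfl
      have k₄ := k₄ p r rfl
      by_cases tA : ShortlyLinked ρ (2 ^ q * 2 ^ r) s a A₁ ∧ ShortlyLinked ρ (2 ^ q * 2 ^ r) a t A₂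
      · refine .inl (tA.1.trans hρ h4 tA.2 ?_ ?_) <;> intro x hx <;> simp [hx]
      by_cases tB : ShortlyLinked ρ (2 ^ q * 2 ^ r) s b B₁ ∧ ShortlyLinked ρ (2 ^ q * 2 ^ r) b t B₂
      · refine .inl (tB.1.trans hρ h4 tB.2 ?_ ?_) <;> intro x hx <;> simp [hx]
      right
      simp only [Multiset.map_add, Multiset.sum_add]
      rw [pow_succ (1 / 2 : ℝ) (p + 1), pow_succ (4 : ℝ), Nat.cast_succ]
      generalize ((r + p : ℕ) : ℝ) = z at *
      generalize (4 : ℝ) ^ (r + p) = M at *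
      generalize (1 / 2 : ℝ) ^ (p + 1) = e' at *
      generalize (1 / 2 : ℝ) ^ q = e at *
      rw [not_and_or] at tA tB
      rcases tA with tA | tA <;> rcases tB with tB | tB
      · linarith [k₁.resolve_left tA, k₃.resolve_left tB]
      · linarith [k₁.resolve_left tA, k₄.resolve_left tB]
      · linarith [k₂.resolve_left tA, k₃.resolve_left tB]
      · linarith [k₂.resolve_left tA, k₄.resolve_left tB]

/-- The dyadic scales up to a given number sum to at most twice that number. -/
theorem sum_two_pow_ite_le (P : ℕ → Prop) [DecidablePred P] {g : ℝ} (hg : 0 ≤ g)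
    (hP : ∀ q, P q → 2 ^ q ≤ 2 * g) (Q : ℕ) :
    ∑ q ∈ Finset.range Q, (2 : ℝ) ^ q * (if P q then 1 else 0) ≤ 4 * g := by
  induction Q with
  | zero => simpa using hg
  | succ Q ih =>
    by_cases h : P Q
    · have hle : ∑ q ∈ Finset.range (Q + 1), (2 : ℝ) ^ q * (if P q then 1 else 0) ≤
          ∑ q ∈ Finset.range (Q + 1), (2 : ℝ) ^ q :=
        Finset.sum_le_sum fun q _ => mul_le_of_le_one_right (by positivity) (by split_ifs <;> simp)
      have hgeom := geom_sum_eq (by norm_num : (2 : ℝ) ≠ 1) (Q + 1)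
      rw [hgeom, pow_succ] at hle
      linarith [hP Q h]
    · rw [Finset.sum_range_succ, if_neg h]
      linarith

/-- The total gradient of a dominating tree metric over a diamond of depth `2 ^ r`. -/
theorem IsDiamond.le_sum_gradient {X : Type*} {d ρ : X → X → ℝ} (hd : IsMetric d)
    (hρ : IsMetric ρ) (h4 : FourPointCond ρ) (hdom : ∀ x y, d x y ≤ ρ x y) {r : ℕ} (hr : 4 ≤ r)
    {G : X → ℝ} (hG0 : ∀ x, 0 ≤ G x) (hG : ∀ x y, x ≠ y → ρ x y / d x y ≤ G x)
    {s t : X} {L : Multiset X} (h : IsDiamond d (2 ^ r) s t L) :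
    2 * 4 ^ (2 ^ r) * ((2 ^ r : ℝ) ^ 2 / 384) ≤ (L.map G).sum := by
  classical
  let P : ℕ → X → Prop := fun q x => ∃ y, 0 < ρ x y ∧ 2 ^ q * d x y ≤ 2 * ρ x y
  have hP : ∀ x q, P q x → 2 ^ q ≤ 2 * G x := by
    rintro x q ⟨y, hpos, hle⟩
    have hne : x ≠ y := fun h => hpos.ne' ((hρ.2.1 x y).2 h)
    have hdpos : 0 < d x y := lt_of_le_of_ne (hd.1 x y) fun h => hne ((hd.2.1 x y).1 h.symm)
    have := (le_div_iff₀ hdpos).2 hle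
    rw [mul_div_assoc] at this
    linarith [hG x y hne]
  have hlevel : ∀ q ∈ Finset.Ico r (2 ^ (r - 1)), 2 * 4 ^ (2 ^ r) * ((2 ^ r : ℝ) / 24) ≤
      (L.map fun x => (2 : ℝ) ^ q * (if P q x then 1 else 0)).sum := by
    intro q hq
    rw [Finset.mem_Ico] at hq
    have := (h.le_sum_and hd hρ h4 hdom (q := q) (K := 2 ^ r) (φ := fun x => if P q x then 1 else 0)
      (Nat.pow_le_pow_right two_pos hq.1) (fun x => by positivity)
      (fun x y hpos hle => by rw [if_pos ⟨y, hpos, hle⟩]) le_rfl).1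
    rw [Multiset.sum_map_mul_left]
    refine le_trans ?_ (mul_le_mul_of_nonneg_left this (by positivity : (0 : ℝ) ≤ 2 ^ q))
    have h2q : (2 : ℝ) ^ q * (1 / 2 : ℝ) ^ q = 1 := by rw [← mul_pow]; norm_num
    have hq' : (q : ℝ) ≤ 2 ^ r / 2 := by
      have h1 : (q : ℝ) ≤ 2 ^ (r - 1) := by exact_mod_cast hq.2.le
      have h2 : (2 : ℝ) ^ r = 2 ^ (r - 1) * 2 := by rw [← pow_succ]; congr 1; omega
      linarith
    calc 2 * 4 ^ (2 ^ r) * ((2 ^ r : ℝ) / 24)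
        ≤ 2 * 4 ^ (2 ^ r) * ((2 ^ r - q) / 12) := by gcongr ?_ * ?_; linarith
      _ = 2 * 4 ^ (2 ^ r) * ((2 : ℝ) ^ q * (1 / 2 : ℝ) ^ q * (2 ^ r - q) / 12) := by
        rw [h2q, one_mul]
      _ = _ := by push_cast; ring
  have hcount : (2 : ℝ) ^ r / 4 ≤ ((Finset.Ico r (2 ^ (r - 1))).card : ℝ) := by
    obtain ⟨u, rfl⟩ : ∃ u, r = u + 4 := ⟨r - 4, by omega⟩
    have hu : u < 2 ^ u := Nat.lt_two_pow_self
    have : 2 ^ u * 4 ≤ 2 ^ (u + 4 - 1) - (u + 4) := by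
      rw [show u + 4 - 1 = u + 3 by omega, pow_add]
      omega
    rw [Nat.card_Ico]
    have h' : ((2 ^ u * 4 : ℕ) : ℝ) ≤ ((2 ^ (u + 4 - 1) - (u + 4) : ℕ) : ℝ) := by
      exact_mod_cast this
    refine le_trans (le_of_eq ?_) h'
    push_cast
    ring
  have hswap : ∑ q ∈ Finset.Ico r (2 ^ (r - 1)),
      (L.map fun x => (2 : ℝ) ^ q * (if P q x then 1 else 0)).sum ≤ 4 * (L.map G).sum := by
    rw [← Multiset.sum_map_sum, ← Multiset.sum_map_mul_left]
    refine Multiset.sum_map_le_sum_map _ _ fun x _ => ?_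
    refine le_trans ?_ (sum_two_pow_ite_le (fun q => P q x) (hG0 x) (hP x) (2 ^ (r - 1)))
    exact Finset.sum_le_sum_of_subset_of_nonneg
      (fun q hq => Finset.mem_range.2 (Finset.mem_Ico.1 hq).2) fun q _ _ => by positivity
  have hsum := Finset.card_nsmul_le_sum _ _ _ hlevel
  rw [nsmul_eq_mul] at hsum
  have := mul_le_mul_of_nonneg_right hcount
    (by positivity : (0 : ℝ) ≤ 2 * 4 ^ (2 ^ r) * ((2 ^ r : ℝ) / 24))
  linarith

/-- Lower bound: there is a universal `c > 0` and arbitrarily large `n`-point metric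
spaces such that for every finitely supported distribution over dominating tree metrics,
some point has expected maximum gradient at least `c (log n)²`. -/
theorem maximum_gradient_lower_bound :
    ∃ c : ℝ, 0 < c ∧
      ∀ N : ℕ, ∃ n : ℕ, N ≤ n ∧
        ∃ d : Fin n → Fin n → ℝ, IsMetric d ∧
          ∀ (m : ℕ) (w : Fin m → ℝ) (ρ : Fin m → Fin n → Fin n → ℝ),
            (∀ i, 0 ≤ w i) → (∑ i, w i = 1) →
            (∀ i, w i ≠ 0 →
              IsMetric (ρ i) ∧ FourPointCond (ρ i) ∧ ∀ x y, d x y ≤ ρ i x y) →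
            ∃ x : Fin n,
              c * (Real.log n) ^ 2 ≤
                ∑ i, w i * (⨆ y : {y : Fin n // y ≠ x}, ρ i x y.1 / d x y.1) := by
  classical
  refine ⟨1 / 3456, by norm_num, fun N => ?_⟩
  obtain ⟨r, hr4, hrN⟩ : ∃ r : ℕ, 4 ≤ r ∧ N ≤ r := ⟨max N 4, le_max_right _ _, le_max_left _ _⟩
  obtain ⟨X, _, -, s, t, L, -, -, -, hL⟩ := exists_isDiamond (2 ^ r)
  have hnN : N ≤ L.toFinset.card :=
    calc N ≤ 2 ^ r := hrN.trans Nat.lt_two_pow_self.le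
      _ ≤ 2 ^ (2 ^ r) := Nat.lt_two_pow_self.le
      _ ≤ _ := hL.two_pow_le_card_toFinset dist_self
  have hn : L.toFinset.card ≤ 2 * 4 ^ (2 ^ r) := hL.card_eq ▸ L.toFinset_card_le
  generalize hcard : L.toFinset.card = n at hnN hn
  let e : L.toFinset ≃ Fin n := L.toFinset.equivFinOfCardEq hcard
  let f : Fin n → X := fun i => (e.symm i : X)
  have hf : Function.Injective f := Subtype.val_injective.comp e.symm.injective
  have hs : s ∈ L.toFinset := Multiset.mem_toFinset.2 hL.terminals_mem.1
  let g : X → Fin n := fun x => if hx : x ∈ L.toFinset then e ⟨x, hx⟩ else e ⟨s, hs⟩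
  have hfg : ∀ x ∈ L, f (g x) = x := fun x hx => by
    simp [f, g, hx]
  let d : Fin n → Fin n → ℝ := fun i j => dist (f i) (f j)
  have hd : IsMetric d := ⟨fun _ _ => dist_nonneg, fun x y => dist_eq_zero.trans hf.eq_iff,
    fun _ _ => dist_comm _ _, fun _ _ _ => dist_triangle _ _ _⟩
  have hD : IsDiamond d (2 ^ r) (g s) (g t) (L.map g) := hL.map g fun x hx y hy => by
    simp only [d, hfg x hx, hfg y hy]
  refine ⟨n, hnN, d, hd, fun m w ρ hw hw1 hρ => ?_⟩
  let G : Fin m → Fin n → ℝ := fun i x => ⨆ y : {y : Fin n // y ≠ x}, ρ i x y.1 / d x y.1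
  set M := L.map g
  have hGsum : ∀ i, w i * (2 * 4 ^ (2 ^ r) * ((2 ^ r : ℝ) ^ 2 / 384)) ≤
      w i * (M.map (G i)).sum := by
    intro i
    by_cases hi : w i = 0
    · simp [hi]
    obtain ⟨hm, h4, hdom⟩ := hρ i hi
    refine mul_le_mul_of_nonneg_left (hD.le_sum_gradient hd hm h4 hdom hr4 (fun x => ?_)
      fun x y hxy => ?_) (hw i)
    · exact Real.iSup_nonneg fun y => div_nonneg (hm.1 _ _) (hd.1 _ _)
    · exact le_ciSup (f := fun y : {y : Fin n // y ≠ x} => ρ i x y.1 / d x y.1)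
        (Set.finite_range _).bddAbove ⟨y, hxy.symm⟩
  have htotal : 2 * 4 ^ (2 ^ r) * ((2 ^ r : ℝ) ^ 2 / 384) ≤
      (M.map fun x => ∑ i, w i * G i x).sum := by
    rw [Multiset.sum_map_sum]
    simp only [Multiset.sum_map_mul_left]
    refine le_trans (le_of_eq ?_) (Finset.sum_le_sum fun i _ => hGsum i)
    rw [← Finset.sum_mul, hw1, one_mul]
  have hlog : Real.log n ≤ 3 * 2 ^ r := by
    have hn0 : (0 : ℝ) < n := by
      exact_mod_cast (Fin.pos (g s))
    have hn' : (n : ℝ) ≤ 8 ^ (2 ^ r) := by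
      have h2 : 2 ≤ 2 ^ (2 ^ r) := Nat.le_self_pow (by positivity) 2
      have : n ≤ 8 ^ (2 ^ r) := hn.trans (by
        rw [show 8 = 2 * 4 by norm_num, mul_pow]
        exact Nat.mul_le_mul_right _ h2)
      exact_mod_cast this
    have h8 : Real.log 8 ≤ 3 := by
      rw [show (8 : ℝ) = 2 ^ 3 by norm_num, Real.log_pow]
      push_cast
      linarith [Real.log_two_lt_d9]
    calc Real.log n ≤ Real.log (8 ^ (2 ^ r)) := Real.log_le_log hn0 hn'
      _ = 2 ^ r * Real.log 8 := by rw [Real.log_pow]; push_cast; rfl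
      _ ≤ 2 ^ r * 3 := by gcongr
      _ = _ := mul_comm _ _
  have hlog2 : Real.log n ^ 2 ≤ (3 * 2 ^ r) ^ 2 :=
    pow_le_pow_left₀ (Real.log_natCast_nonneg n) hlog 2
  by_contra! hcon
  have hlt : (M.map fun x => ∑ i, w i * G i x).sum <
      (M.map fun _ => (2 ^ r : ℝ) ^ 2 / 384).sum := by
    refine Multiset.sum_lt_sum_of_nonempty ?_ fun x _ => (hcon x).trans_le (by linarith)
    exact fun h0 => by simpa [h0] using hD.terminals_mem.1
  rw [Multiset.map_const', Multiset.sum_replicate, hD.card_eq, nsmul_eq_mul] at hlt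
  push_cast at hlt
  linarith
end

section
/- Let (X, d_X) be an n-point metric space, μ a positive measure on X, and Δ > 0. Then there exists a finitely supported probability distribution over Δ-bounded partitions P of X such that: (i) for every x,y ∈ X with d_X(x,y) ≤ Δ/(2n), deterministically P(x) = P(y); and (ii) for every x ∈ X and every t with 0 < t ≤ Δ/16, the probability that B_X(x,t) is not contained in P(x) is at most (32t/Δ)·log( μ(B_X(x,Δ)) / μ(B_X(x,Δ/16)) ). -/
/-- The closed ball of radius `t` around `x`, as a finset. -/
noncomputable def cball {X : Type*} [Fintype X] (d : X → X → ℝ) (x : X) (t : ℝ) :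
    Finset X :=
  Finset.univ.filter (fun y => d x y ≤ t)

/-! ### The chain pseudometric of a cost function -/

/-- The total cost of the chain from `x` to `y` through the intermediate points `l`. -/
def chainCost {X : Type*} (c : X → X → ℝ) : X → List X → X → ℝ
  | x, [], y => c x y
  | x, z :: l, y => c x z + chainCost c z l y

/-- The infimum of the costs of the chains from `x` to `y`. -/
noncomputable def chainDist {X : Type*} (c : X → X → ℝ) (x y : X) : ℝ :=
  ⨅ l : List X, chainCost c x l y

section Chain

variable {X : Type*} {c : X → X → ℝ}

lemma chainCost_append (x y z : X) (l l' : List X) :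
    chainCost c x (l ++ y :: l') z = chainCost c x l y + chainCost c y l' z := by
  induction l generalizing x with
  | nil => rfl
  | cons w l ih => simp [chainCost, ih, add_assoc]

lemma chainCost_reverse (hc : ∀ x y, c x y = c y x) (x y : X) (l : List X) :
    chainCost c y l.reverse x = chainCost c x l y := by
  induction l generalizing x with
  | nil => exact hc y x
  | cons z l ih =>
    rw [List.reverse_cons, chainCost_append, ih, chainCost, chainCost, hc z x, add_comm]

lemma chainCost_nonneg (hc : ∀ x y, 0 ≤ c x y) (x y : X) (l : List X) :
    0 ≤ chainCost c x l y := by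
  induction l generalizing x with
  | nil => exact hc x y
  | cons z l ih => exact add_nonneg (hc x z) (ih z)

lemma chainDist_le_chainCost (hc : ∀ x y, 0 ≤ c x y) (x y : X) (l : List X) :
    chainDist c x y ≤ chainCost c x l y :=
  ciInf_le ⟨0, by rintro _ ⟨l, rfl⟩; exact chainCost_nonneg hc x y l⟩ l

lemma chainDist_comm (hc : ∀ x y, c x y = c y x) (x y : X) :
    chainDist c x y = chainDist c y x :=
  (Function.Involutive.surjective List.reverse_involutive).iInf_congr List.reverse
    fun l => chainCost_reverse hc x y l

lemma chainDist_triangle (hc : ∀ x y, 0 ≤ c x y) (x y z : X) :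
    chainDist c x z ≤ chainDist c x y + chainDist c y z := by
  refine le_ciInf_add_ciInf fun l l' => ?_
  rw [← chainCost_append]
  exact chainDist_le_chainCost hc x z _

open Classical in
/-- Skipping cycles, a chain loses at most `ε` per point it visits when passing from `d`
to a cost that is at least `d - ε`. -/
lemma le_chainCost_add {d : X → X → ℝ} {ε : ℝ} (hd : ∀ x y z, d x z ≤ d x y + d y z)
    (hε : 0 ≤ ε) (hc : ∀ x y, 0 ≤ c x y) (hdc : ∀ x y, d x y ≤ c x y + ε) (x y : X)
    (l : List X) : d x y ≤ chainCost c x l y + (x :: l).toFinset.card * ε := by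
  induction hk : l.length using Nat.strong_induction_on generalizing x l with
  | _ k ih =>
  subst hk
  by_cases hx : x ∈ l
  · obtain ⟨l₁, l₂, rfl⟩ := List.append_of_mem hx
    have h := ih l₂.length (by simp; omega) x l₂ rfl
    have hcard : ((x :: l₂).toFinset.card : ℝ) ≤ (x :: (l₁ ++ x :: l₂)).toFinset.card := by
      exact_mod_cast Finset.card_le_card fun a ha => by
        simp only [List.mem_toFinset, List.mem_cons, List.mem_append] at ha ⊢
        tauto
    rw [chainCost_append]
    have := chainCost_nonneg hc x x l₁
    have := mul_le_mul_of_nonneg_right hcard hε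
    linarith
  · rw [List.toFinset_cons, Finset.card_insert_of_notMem (by simpa using hx)]
    cases l with
    | nil => simpa [chainCost] using hdc x y
    | cons z l =>
      have h := ih l.length (by simp) z l rfl
      have h₁ := hd x z y
      have h₂ := hdc x z
      simp only [chainCost]
      push_cast
      linarith

end Chain

/-- Contracting all the pairs at distance at most `Δ / (2n)` in an `n`-point metric space
yields a pseudometric that differs from the original metric by at most `Δ / 2`. -/
lemma exists_contracted_pseudometric {X : Type*} [Fintype X] {d : X → X → ℝ}
    (hd : IsMetric d) {Δ : ℝ} (hΔ : 0 < Δ) :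
    ∃ ρ : X → X → ℝ, (∀ x y, ρ x y = ρ y x) ∧ (∀ x y z, ρ x z ≤ ρ x y + ρ y z) ∧
      (∀ x y, ρ x y ≤ d x y) ∧ (∀ x y, d x y ≤ ρ x y + Δ / 2) ∧
      (∀ x y, d x y ≤ Δ / (2 * Fintype.card X) → ρ x y ≤ 0) := by
  classical
  obtain ⟨hd0, -, hdsymm, hdtri⟩ := hd
  set ε : ℝ := Δ / (2 * Fintype.card X) with hε
  have hε0 : 0 ≤ ε := by positivity
  set c : X → X → ℝ := fun x y => if d x y ≤ ε then 0 else d x y with hcdef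
  have hc0 : ∀ x y, 0 ≤ c x y := fun x y => by
    simp only [hcdef]; split_ifs; exacts [le_rfl, hd0 x y]
  refine ⟨chainDist c, chainDist_comm fun x y => by simp only [hcdef, hdsymm x y],
    chainDist_triangle hc0, fun x y => ?_, fun x y => ?_, fun x y hxy => ?_⟩
  · refine (chainDist_le_chainCost hc0 x y []).trans ?_
    simp only [chainCost, hcdef]; split_ifs; exacts [hd0 x y, le_rfl]
  · rw [← sub_le_iff_le_add]
    refine le_ciInf fun l => ?_
    have h := le_chainCost_add hdtri hε0 hc0 (fun x y => by
      simp only [hcdef]; split_ifs <;> linarith) x y l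
    have hcard : ((x :: l).toFinset.card : ℝ) ≤ Fintype.card X := by
      exact_mod_cast Finset.card_le_univ _
    have hpos : (0 : ℝ) < Fintype.card X := by
      exact_mod_cast Fintype.card_pos_iff.mpr ⟨x⟩
    have h₂ : Fintype.card X * ε = Δ / 2 := by rw [hε]; field_simp
    have := mul_le_mul_of_nonneg_right hcard hε0
    linarith
  · refine (chainDist_le_chainCost hc0 x y []).trans ?_
    simp [chainCost, hcdef, hxy]

/-! ### Weighted random orders -/

open Classical in
/-- Sampling without replacement proportionally to `μ` yields a random order of `S` in which
the first element of `A ⊆ S` is distributed proportionally to `μ`. The order is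
recorded through the function `first` selecting the first element of each set. -/
lemma exists_weighted_random_order {X : Type} [Nonempty X] {μ : X → ℝ} (hμ : ∀ x, 0 < μ x)
    (S : Finset X) :
    ∃ (Ω : Type) (_ : Fintype Ω) (q : Ω → ℝ) (first : Ω → Finset X → X),
      (∀ ω, 0 ≤ q ω) ∧ (∑ ω, q ω = 1) ∧
      (∀ ω, ∀ A ⊆ S, A.Nonempty → first ω A ∈ A) ∧
      (∀ ω, ∀ A ⊆ S, ∀ B ⊆ A, first ω A ∈ B → first ω B = first ω A) ∧
      (∀ A ⊆ S, A.Nonempty → ∀ C ⊆ A,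
        ∑ ω, (if first ω A ∈ C then q ω else 0) = (∑ y ∈ C, μ y) / ∑ y ∈ A, μ y) := by
  induction S using Finset.strongInduction with
  | H S ih =>
  rcases S.eq_empty_or_nonempty with rfl | hS
  · refine ⟨Unit, inferInstance, fun _ => 1, fun _ _ => Classical.arbitrary X, by simp, by simp,
      ?_, by simp, ?_⟩
    · rintro - A hA ⟨a, ha⟩
      exact absurd (hA ha) (by simp)
    · rintro A hA ⟨a, ha⟩
      exact absurd (hA ha) (by simp)
  choose Ω hΩ q first hq0 hq1 hmem hcons hprob using
    fun z : S => ih (S.erase z) (Finset.erase_ssubset z.2)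
  have hsum : ∀ A : Finset X, A.Nonempty → 0 < ∑ y ∈ A, μ y :=
    fun A hA => Finset.sum_pos (fun y _ => hμ y) hA
  have hSpos := hsum S hS
  refine ⟨Σ z, Ω z, inferInstance, fun ω => μ ω.1 / (∑ y ∈ S, μ y) * q ω.1 ω.2,
    fun ω A => if (ω.1 : X) ∈ A then (ω.1 : X) else first ω.1 ω.2 A,
    fun ω => mul_nonneg (div_nonneg (hμ _).le hSpos.le) (hq0 _ _), ?_, ?_, ?_, ?_⟩
  · rw [Fintype.sum_sigma]
    simp only [← Finset.mul_sum, hq1, mul_one]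
    rw [← Finset.sum_div, Finset.sum_coe_sort S μ, div_self hSpos.ne']
  · rintro ⟨z, ω⟩ A hA hne
    dsimp only
    split_ifs with hz
    · exact hz
    · exact hmem z ω A (Finset.subset_erase.mpr ⟨hA, hz⟩) hne
  · rintro ⟨z, ω⟩ A hA B hB
    dsimp only
    by_cases hz : (z : X) ∈ A
    · simp +contextual [hz]
    · have hzB : (z : X) ∉ B := fun h => hz (hB h)
      simp only [hz, hzB, if_false]
      exact hcons z ω A (Finset.subset_erase.mpr ⟨hA, hz⟩) B hB
  · intro A hA hne C hC
    have hApos := hsum A hne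
    rw [Fintype.sum_sigma]
    have hterm : ∀ z : S, ∑ ω : Ω z,
        (if (if (z : X) ∈ A then (z : X) else first z ω A) ∈ C then
          μ z / (∑ y ∈ S, μ y) * q z ω else 0) =
        μ z / (∑ y ∈ S, μ y) * ((if (z : X) ∈ C then 1 else 0) +
          (if (z : X) ∈ A then 0 else 1) * ((∑ y ∈ C, μ y) / ∑ y ∈ A, μ y)) := by
      intro z
      by_cases hz : (z : X) ∈ A
      · by_cases hzC : (z : X) ∈ C <;> simp [hz, hzC, ← Finset.mul_sum, hq1]
      · have hzC : (z : X) ∉ C := fun h => hz (hC h)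
        simp only [hz, hzC, if_false, zero_add, one_mul]
        rw [← hprob z A (Finset.subset_erase.mpr ⟨hA, hz⟩) hne C hC, Finset.mul_sum]
        simp only [mul_ite, mul_zero]
    rw [Finset.sum_congr rfl fun z _ => hterm z, Finset.sum_coe_sort S fun z =>
      μ z / (∑ y ∈ S, μ y) * ((if z ∈ C then 1 else 0) +
          (if z ∈ A then 0 else 1) * ((∑ y ∈ C, μ y) / ∑ y ∈ A, μ y))]
    have h₁ : ∑ z ∈ S, μ z * (if z ∈ C then 1 else 0) = ∑ y ∈ C, μ y := by
      simp only [mul_ite, mul_one, mul_zero]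
      rw [← Finset.sum_filter, Finset.filter_mem_eq_inter,
        Finset.inter_eq_right.mpr (hC.trans hA)]
    have h₂ : ∑ z ∈ S, μ z * (if z ∈ A then 0 else 1) = ∑ y ∈ S, μ y - ∑ y ∈ A, μ y := by
      rw [eq_sub_iff_add_eq, ← Finset.sum_sdiff (f := μ) hA, add_left_inj, ← Finset.sum_sdiff hA]
      have hout : ∑ z ∈ S \ A, μ z * (if z ∈ A then 0 else 1) = ∑ z ∈ S \ A, μ z :=
        Finset.sum_congr rfl fun z hz => by simp [(Finset.mem_sdiff.mp hz).2]
      have hin : ∑ z ∈ A, μ z * (if z ∈ A then 0 else 1) = 0 :=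
        Finset.sum_eq_zero fun z hz => by simp [hz]
      rw [hout, hin, add_zero]
    have h₃ : ∀ z ∈ S, μ z / (∑ y ∈ S, μ y) * ((if z ∈ C then 1 else 0) +
          (if z ∈ A then 0 else 1) * ((∑ y ∈ C, μ y) / ∑ y ∈ A, μ y)) =
        (μ z * (if z ∈ C then 1 else 0) + μ z * (if z ∈ A then 0 else 1) *
          ((∑ y ∈ C, μ y) / ∑ y ∈ A, μ y)) / ∑ y ∈ S, μ y := fun z _ => by ring
    rw [Finset.sum_congr rfl h₃, ← Finset.sum_div, Finset.sum_add_distrib, ← Finset.sum_mul,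
      h₁, h₂]
    field_simp
    ring

/-! ### The padding estimate -/

lemma cball_subset_cball {X : Type*} [Fintype X] {d ρ : X → X → ℝ} {x y : X} {s t : ℝ}
    (h : ∀ z, d x z ≤ s → ρ y z ≤ t) : cball d x s ⊆ cball ρ y t := by
  intro z hz
  simp only [cball, Finset.mem_filter, Finset.mem_univ, true_and] at hz ⊢
  exact h z hz

lemma mem_cball {X : Type*} [Fintype X] {d : X → X → ℝ} {x y : X} {t : ℝ} :
    y ∈ cball d x t ↔ d x y ≤ t := by
  simp [cball]

/-- If the first element of the large ball `B(x, R + t)` lies in the small ball `B(x, R - t)`,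
then it is the first element of every ball `B(y, R)` with `y ∈ B(x, t)`. -/
lemma first_cball_eq {X : Type*} [Fintype X] {ρ : X → X → ℝ} (hsymm : ∀ x y, ρ x y = ρ y x)
    (htri : ∀ x y z, ρ x z ≤ ρ x y + ρ y z) {first : Finset X → X}
    (hfirst : ∀ A, ∀ B ⊆ A, first A ∈ B → first B = first A) {x y : X} {R t : ℝ}
    (hxy : ρ x y ≤ t) (hx : first (cball ρ x (R + t)) ∈ cball ρ x (R - t)) :
    first (cball ρ y R) = first (cball ρ x (R + t)) := by
  refine hfirst _ _ (cball_subset_cball fun z hz => ?_) (mem_cball.mpr ?_)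
  · linarith [htri x y z]
  · linarith [htri y x (first (cball ρ x (R + t))), hsymm x y, mem_cball.mp hx]

/-- The increments of a sequence over `K` steps telescope. -/
lemma sum_range_shift_sub_le {a b : ℕ → ℝ} {L U : ℝ} (N K : ℕ) (hLU : L ≤ U)
    (hL : ∀ j, L ≤ b j) (hU : ∀ j < N, a j ≤ U)
    (hab : ∀ j, a j ≤ b (j + K)) :
    ∑ j ∈ Finset.range N, (a j - b j) ≤ K * (U - L) := by
  set c : ℕ → ℝ := fun j => min U (b j)
  calc ∑ j ∈ Finset.range N, (a j - b j)
      ≤ ∑ j ∈ Finset.range N, (c (j + K) - c j) :=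
        Finset.sum_le_sum fun j hj => sub_le_sub
          (le_min (hU j (Finset.mem_range.mp hj)) (hab j)) (min_le_right _ _)
    _ = ∑ i ∈ Finset.range K, (c (N + i) - c i) := by
        have h₁ := Finset.sum_range_add c N K
        have h₂ := Finset.sum_range_add c K N
        rw [add_comm K N] at h₂
        simp only [Finset.sum_sub_distrib, add_comm _ K]
        linarith
    _ ≤ ∑ i ∈ Finset.range K, (U - L) :=
        Finset.sum_le_sum fun i _ => sub_le_sub (min_le_left _ _) (le_min hLU (hL i))
    _ = K * (U - L) := by rw [Finset.sum_const, Finset.card_range, nsmul_eq_mul]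

open Classical in
/-- The first element of `A` avoids `C ⊆ A` with probability at most `log (μ A / μ C)`. -/
lemma prob_first_notMem_le {X Ω : Type*} [Fintype Ω] {μ : X → ℝ} (hμ : ∀ x, 0 < μ x)
    {q : Ω → ℝ} {first : Ω → X} {A C : Finset X} (hC : C.Nonempty) (hCA : C ⊆ A)
    (hq : ∑ ω, q ω = 1)
    (hprob : ∑ ω, (if first ω ∈ C then q ω else 0) = (∑ y ∈ C, μ y) / ∑ y ∈ A, μ y) :
    ∑ ω, (if first ω ∉ C then q ω else 0) ≤
      Real.log (∑ y ∈ A, μ y) - Real.log (∑ y ∈ C, μ y) := by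
  have hCpos : 0 < ∑ y ∈ C, μ y := Finset.sum_pos (fun y _ => hμ y) hC
  have hApos : 0 < ∑ y ∈ A, μ y := Finset.sum_pos (fun y _ => hμ y) (hC.mono hCA)
  have h := Real.one_sub_inv_le_log_of_pos (div_pos hApos hCpos)
  rw [Real.log_div hApos.ne' hCpos.ne', inv_div, ← hprob, ← hq, ← Finset.sum_sub_distrib] at h
  refine le_of_eq_of_le (Finset.sum_congr rfl fun ω _ => ?_) h
  split_ifs <;> simp_all

open Classical in
/-- The parts consisting of the points whose `R`-balls have the same first element. -/
noncomputable def ballPart {X : Type*} [Fintype X] (ρ : X → X → ℝ) (first : Finset X → X)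
    (R : ℝ) (x : X) : Finset X :=
  Finset.univ.filter fun y => first (cball ρ y R) = first (cball ρ x R)

lemma mem_ballPart {X : Type*} [Fintype X] {ρ : X → X → ℝ} {first : Finset X → X}
    {R : ℝ} {x y : X} :
    y ∈ ballPart ρ first R x ↔ first (cball ρ y R) = first (cball ρ x R) := by
  simp [ballPart]

lemma ballPart_eq {X : Type*} [Fintype X] {ρ : X → X → ℝ} {first : Finset X → X}
    {R : ℝ} {x y : X} (h : first (cball ρ y R) = first (cball ρ x R)) :
    ballPart ρ first R y = ballPart ρ first R x := by
  ext z
  rw [mem_ballPart, mem_ballPart, h]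

open Classical in
/-- Quotient version of the FRT padded decomposition: the random `Δ`-bounded partition
never separates points at distance at most `Δ/(2n)`, and for every `x` and
`0 < t ≤ Δ/16` the probability that `B(x,t) ⊄ P(x)` is at most
`(32t/Δ)·log(μ(B(x,Δ))/μ(B(x,Δ/16)))`. -/
theorem frt_padded_decomposition_quotient
    (X : Type) [Fintype X] (d : X → X → ℝ) (hd : IsMetric d)
    (n : ℕ) (hn : Fintype.card X = n)
    (μ : X → ℝ) (hμ : ∀ x, 0 < μ x) (Δ : ℝ) (hΔ : 0 < Δ) :
    ∃ (m : ℕ) (w : Fin m → ℝ) (Part : Fin m → X → Finset X),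
      (∀ i, 0 ≤ w i) ∧ (∑ i, w i = 1) ∧
      (∀ i, w i ≠ 0 →
        (∀ x, x ∈ Part i x) ∧ (∀ x y, y ∈ Part i x → Part i y = Part i x) ∧
        (∀ x, ∀ a ∈ Part i x, ∀ b ∈ Part i x, d a b ≤ Δ) ∧
        (∀ x y, d x y ≤ Δ / (2 * n) → Part i x = Part i y)) ∧
      (∀ x : X, ∀ t : ℝ, 0 < t → t ≤ Δ / 16 →
        ∑ i ∈ Finset.univ.filter (fun i => ¬ cball d x t ⊆ Part i x), w i ≤
          (32 * t / Δ) *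
            Real.log ((∑ y ∈ cball d x Δ, μ y) /
              (∑ y ∈ cball d x (Δ / 16), μ y))) := by
  subst hn
  rcases isEmpty_or_nonempty X with hX | hX
  · exact ⟨1, fun _ => 1, fun _ x => {x}, by simp, by simp,
      fun _ _ => ⟨isEmptyElim, isEmptyElim, isEmptyElim, isEmptyElim⟩, isEmptyElim⟩
  obtain ⟨ρ, hsymm, htri, hρd, hdρ, hclose⟩ := exists_contracted_pseudometric hd hΔ
  obtain ⟨Ω, _, q, first, hq0, hq1, hmem, hcons, hprob⟩ :=
    exists_weighted_random_order hμ (Finset.univ : Finset X)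
  obtain ⟨hd0, hdeq, -, -⟩ := hd
  have hdself : ∀ x, d x x = 0 := fun x => (hdeq x x).mpr rfl
  have hρself : ∀ x, ρ x x ≤ 0 := fun x => (hρd x x).trans (hdself x).le
  -- the radii form a grid finer than the distances between distinct points
  obtain ⟨N, hN0, hN⟩ : ∃ N : ℕ, 0 < N ∧ ∀ x y, x ≠ y → Δ / 8 / N ≤ d x y := by
    have h : ∀ᶠ N : ℕ in Filter.atTop, ∀ x y, x ≠ y → Δ / 8 / N ≤ d x y := by
      refine Filter.eventually_all.mpr fun x => Filter.eventually_all.mpr fun y => ?_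
      by_cases hxy : x = y
      · simp [hxy]
      have hpos : 0 < d x y := lt_of_le_of_ne (hd0 x y) fun h => hxy ((hdeq x y).mp h.symm)
      filter_upwards [(tendsto_const_div_atTop_nhds_zero_nat (Δ / 8)).eventually
        (ge_mem_nhds hpos)] with N h _ using h
    obtain ⟨N, h₁, h₂⟩ := ((Filter.eventually_gt_atTop 0).and h).exists
    exact ⟨N, h₁, h₂⟩
  have hNpos : (0 : ℝ) < N := by exact_mod_cast hN0
  set h : ℝ := Δ / 8 / N with hh
  have hhpos : 0 < h := by positivity
  have hhN : N * h = Δ / 8 := by rw [hh]; field_simp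
  set R : ℕ → ℝ := fun j => Δ / 8 + j * h with hR
  have hRlow : ∀ j, Δ / 8 ≤ R j := fun j => le_add_of_nonneg_right (by positivity)
  have hRhigh : ∀ j < N, R j ≤ Δ / 4 := fun j hj => by
    have : (j : ℝ) * h ≤ N * h :=
      mul_le_mul_of_nonneg_right (by exact_mod_cast hj.le) hhpos.le
    simp only [hR]; linarith
  have hmem' : ∀ ω x j, ρ x (first ω (cball ρ x (R j))) ≤ R j := fun ω x j =>
    mem_cball.mp (hmem ω _ (Finset.subset_univ _)
      ⟨x, mem_cball.mpr ((hρself x).trans (by linarith [hRlow j]))⟩)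
  let e := Fintype.equivFin (Ω × Fin N)
  let W : Ω × Fin N → ℝ := fun i => q i.1 / N
  let P : Ω × Fin N → X → Finset X := fun i => ballPart ρ (first i.1) (R i.2)
  refine ⟨_, fun i => W (e.symm i), fun i => P (e.symm i),
    fun i => div_nonneg (hq0 _) hNpos.le, ?_, fun i _ => ⟨?_, ?_, ?_, ?_⟩, ?_⟩
  · rw [Equiv.sum_comp e.symm W, Fintype.sum_prod_type]
    simp only [W, Finset.sum_const, Finset.card_univ, Fintype.card_fin, nsmul_eq_mul,
      mul_div_cancel₀ _ hNpos.ne', hq1]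
  · exact fun x => mem_ballPart.mpr rfl
  · exact fun x y hy => ballPart_eq (mem_ballPart.mp hy)
  · intro x a ha b hb
    have hab := (mem_ballPart.mp ha).trans (mem_ballPart.mp hb).symm
    have h₁ := hmem' (e.symm i).1 a (e.symm i).2
    have h₂ := hmem' (e.symm i).1 b (e.symm i).2
    rw [hab] at h₁
    rw [hsymm] at h₂
    linarith [hdρ a b, htri a (first (e.symm i).1 (cball ρ b (R (e.symm i).2))) b,
      hRhigh _ (e.symm i).2.2]
  · intro x y hxy
    have h₁ := hclose x y hxy
    have h₂ := hsymm x y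
    refine ballPart_eq (congrArg _ (Finset.Subset.antisymm ?_ ?_)) <;>
      refine cball_subset_cball fun z hz => ?_
    · linarith [htri y x z]
    · linarith [htri x y z]
  · intro x t ht0 ht
    have hballpos : ∀ r, 0 ≤ r → 0 < ∑ y ∈ cball d x r, μ y := fun r hr =>
      Finset.sum_pos (fun y _ => hμ y) ⟨x, mem_cball.mpr ((hdself x).trans_le hr)⟩
    have hlog : ∀ {A B : Finset X}, x ∈ A → A ⊆ B →
        Real.log (∑ y ∈ A, μ y) ≤ Real.log (∑ y ∈ B, μ y) := fun hA hAB =>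
      Real.log_le_log (Finset.sum_pos (fun y _ => hμ y) ⟨x, hA⟩)
        (Finset.sum_le_sum_of_subset_of_nonneg hAB fun y _ _ => (hμ y).le)
    rw [Real.log_div (hballpos _ hΔ.le).ne' (hballpos _ (by positivity)).ne']
    set L := Real.log (∑ y ∈ cball d x (Δ / 16), μ y)
    set U := Real.log (∑ y ∈ cball d x Δ, μ y)
    have hLU : L ≤ U := hlog (mem_cball.mpr ((hdself x).trans_le (by positivity)))
      (cball_subset_cball fun z hz => by linarith)
    rw [Finset.sum_filter]
    rw [Equiv.sum_comp e.symm fun i => if ¬ cball d x t ⊆ P i x then W i else 0]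
    by_cases hth : t < h
    · have hsub : ∀ i, cball d x t ⊆ P i x := fun i y hy => by
        by_cases hxy : x = y
        · exact hxy ▸ mem_ballPart.mpr rfl
        · linarith [hN x y hxy, mem_cball.mp hy]
      simp only [hsub, not_true_eq_false, if_false, Finset.sum_const_zero]
      exact mul_nonneg (by positivity) (sub_nonneg.mpr hLU)
    push Not at hth
    let f : ℝ → ℝ := fun r => Real.log (∑ y ∈ cball ρ x r, μ y)
    have hcut : ∀ j, ∑ ω, (if ¬ cball d x t ⊆ ballPart ρ (first ω) (R j) x then q ω else 0) ≤
        f (R j + t) - f (R j - t) := by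
      intro j
      have hxC : x ∈ cball ρ x (R j - t) :=
        mem_cball.mpr ((hρself x).trans (by linarith [hRlow j]))
      have hCA : cball ρ x (R j - t) ⊆ cball ρ x (R j + t) :=
        cball_subset_cball fun z hz => by linarith
      refine le_trans (Finset.sum_le_sum fun ω _ => ?_) (prob_first_notMem_le hμ ⟨x, hxC⟩ hCA hq1
        (hprob _ (Finset.subset_univ _) ⟨x, hCA hxC⟩ _ hCA))
      by_cases hω : first ω (cball ρ x (R j + t)) ∈ cball ρ x (R j - t)
      · have hsub : cball d x t ⊆ ballPart ρ (first ω) (R j) x := fun y hy => by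
          have hfirst := fun A => hcons ω A (Finset.subset_univ A)
          exact mem_ballPart.mpr ((first_cball_eq hsymm htri hfirst
            ((hρd x y).trans (mem_cball.mp hy)) hω).trans
            (first_cball_eq hsymm htri hfirst ((hρself x).trans ht0.le) hω).symm)
        simp [hsub, hω]
      · simp only [hω, not_false_eq_true, if_true]
        split_ifs
        exacts [hq0 ω, le_rfl]
    set K : ℕ := ⌈2 * t / h⌉₊
    have hKle : (K : ℝ) ≤ 4 * t / h := by
      have h₁ : (K : ℝ) < 2 * t / h + 1 := Nat.ceil_lt_add_one (by positivity)
      have h₂ : 1 ≤ 2 * t / h := by rw [le_div_iff₀ hhpos]; linarith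
      have h₃ : 4 * t / h = 2 * t / h + 2 * t / h := by ring
      linarith
    have hKge : 2 * t ≤ K * h := (div_le_iff₀ hhpos).mp (Nat.le_ceil _)
    have htel : ∑ j ∈ Finset.range N, (f (R j + t) - f (R j - t)) ≤ K * (U - L) := by
      refine sum_range_shift_sub_le (a := fun j => f (R j + t)) (b := fun j => f (R j - t))
        N K hLU ?_ ?_ ?_
      · exact fun j => hlog (mem_cball.mpr ((hdself x).trans_le (by positivity)))
          (cball_subset_cball fun z hz => by linarith [hρd x z, hRlow j])
      · exact fun j hj => hlog (mem_cball.mpr ((hρself x).trans (by linarith [hRlow j])))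
          (cball_subset_cball fun z hz => by linarith [hdρ x z, hRhigh j hj])
      · intro j
        refine hlog (mem_cball.mpr ((hρself x).trans (by linarith [hRlow j])))
          (cball_subset_cball fun z hz => hz.trans ?_)
        simp only [hR]; push_cast; linarith
    calc ∑ i, (if ¬ cball d x t ⊆ P i x then W i else 0)
        = (∑ j : Fin N, ∑ ω,
            (if ¬ cball d x t ⊆ ballPart ρ (first ω) (R j) x then q ω else 0)) / N := by
          rw [Fintype.sum_prod_type_right]
          simp only [Finset.sum_div, ite_div, zero_div, P, W]
      _ ≤ (∑ j : Fin N, (f (R j + t) - f (R j - t))) / N := by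
          gcongr with j
          exact hcut j
      _ = (∑ j ∈ Finset.range N, (f (R j + t) - f (R j - t))) / N := by
          rw [Fin.sum_univ_eq_sum_range fun j => f (R j + t) - f (R j - t)]
      _ ≤ 4 * t / h * (U - L) / N := by
          gcongr
          exact htel.trans (mul_le_mul_of_nonneg_right hKle (sub_nonneg.mpr hLU))
      _ = 32 * t / Δ * (U - L) := by
          rw [hh]; field_simp; ring
end
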